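/- arXiv:1707.09523 — 5 statements merged into one kernel-verified Lean document; each statement's English description precedes it below -/
import Mathlib

section
/- Let F : ℂ → ℂ be entire, let f be its restriction to ℝ, let m ∈ ℝ and x ∈ ℝ. Then the series Σ_{n=0}^{∞} (m^n/n!) · ((QD)^n f)(x) converges and its sum equals f(e^m · x); that is, the operator exp(m·QD) acts on entire functions as the dilation f(x) ↦ f(e^m x). -/
open Complex

/-- The operator `QD` : `(QD f)(x) = x · f'(x)`. -/
noncomputable def QD (f : ℝ → ℂ) : ℝ → ℂ :=
  fun x => (x : ℂ) * deriv f x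

theorem QD_comp_ofReal {F : ℂ → ℂ} (hF : Differentiable ℂ F) (t : ℝ) :
    QD (fun u : ℝ => F u) t = (t : ℂ) * deriv F t := by
  rw [QD, (hF (t : ℂ)).hasDerivAt.comp_ofReal.deriv]

theorem deriv_comp_mul_exp {F : ℂ → ℂ} (hF : Differentiable ℂ F) (c : ℂ) :
    deriv (fun s => F (c * exp s)) = fun s => c * exp s * deriv F (c * exp s) := by
  funext s
  have h := (hF (c * exp s)).hasDerivAt.comp s ((hasDerivAt_exp s).const_mul c)
  exact h.deriv.trans (mul_comm _ _)

/-- In the variable `s = log t`, the operator `QD` becomes differentiation. -/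
theorem iteratedDeriv_comp_mul_exp_zero {F : ℂ → ℂ} (hF : Differentiable ℂ F) (x : ℝ) (n : ℕ) :
    iteratedDeriv n (fun s => F (x * exp s)) 0 = QD^[n] (fun t : ℝ => F t) x := by
  induction n generalizing F with
  | zero => simp
  | succ n ih =>
    rw [iteratedDeriv_succ', deriv_comp_mul_exp hF, Function.iterate_succ_apply,
      funext (QD_comp_ofReal hF)]
    exact ih (F := fun z => z * deriv F z)
      (differentiable_id.mul (hF.contDiff.differentiable_deriv_two))

theorem exp_mQD_is_dilation (F : ℂ → ℂ) (hF : Differentiable ℂ F) (m x : ℝ)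
    (f : ℝ → ℂ) (hf : ∀ t : ℝ, f t = F (t : ℂ)) :
    HasSum (fun n : ℕ => (m : ℂ) ^ n / (Nat.factorial n : ℂ) * (QD^[n] f) x)
      (f (Real.exp m * x)) := by
  obtain rfl : f = fun t : ℝ => F t := funext hf
  have hG : Differentiable ℂ fun s => F (x * exp s) :=
    hF.comp (differentiable_exp.const_mul (x : ℂ))
  have h := hasSum_taylorSeries_of_entire hG 0 m
  simp only [iteratedDeriv_comp_mul_exp_zero hF, sub_zero, smul_eq_mul] at h
  rw [hf, mul_comm (Real.exp m) x, ofReal_mul, ofReal_exp]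
  have hterm (n : ℕ) : (m : ℂ) ^ n / (Nat.factorial n : ℂ) * QD^[n] (fun t : ℝ => F t) x =
      (Nat.factorial n : ℂ)⁻¹ * ((m : ℂ) ^ n * QD^[n] (fun t : ℝ => F t) x) := by
    ring
  simpa only [hterm] using h
end

section
/- Let φ and ψ be odd Schwartz functions on ℝ with complex values, and define (A_oχ)(z) = (1/(2π^{3/4})) ∫_ℝ p · e^{i z p²/2} · χ(p) dp for Im z > 0. Then ∫_0^∞ ∫_ℝ (A_oφ)(b + i a) · conj((A_oψ)(b + i a)) · a^{−1/2} db da = ∫_ℝ φ(p) · conj(ψ(p)) dp; i.e., A_o is an isometry from the odd Schwartz functions (with the L²(ℝ) inner product) into the space H_{−1/2} of analytic functions on the upper half-plane square-integrable with respect to dμ_{−1/2}(z) = (Im z)^{−1/2} dA(z). -/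
open MeasureTheory Complex Real SchwartzMap

open scoped FourierTransform ContDiff in
theorem coeFn_fourier_toLp_ae_eq {f : ℝ → ℂ} (hf : Integrable f) (hf2 : MemLp f 2) :
    (𝓕 (hf2.toLp f) : Lp ℂ 2 (volume : Measure ℝ)) =ᵐ[volume] 𝓕 f := by
  refine ae_eq_of_integral_contDiff_smul_eq
    ((Lp.memLp (𝓕 (hf2.toLp f))).locallyIntegrable (by norm_num)) ?_ ?_
  · refine Continuous.locallyIntegrable ?_
    exact VectorFourier.fourierIntegral_continuous Real.continuous_fourierChar
      (L := innerₗ ℝ) continuous_inner hf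
  · intro g hg hgc
    let G : 𝓢(ℝ, ℂ) := HasCompactSupport.toSchwartzMap (f := fun x => (g x : ℂ))
      (hgc.comp_left Complex.ofReal_zero) (Complex.ofRealCLM.contDiff.comp hg)
    have hG : ∀ x, G x = (g x : ℂ) := fun x => rfl
    have h := congrArg (fun T : 𝓢'(ℝ, ℂ) => T G)
      (Lp.fourier_toTemperedDistribution_eq (hf2.toLp f))
    simp only [TemperedDistribution.fourier_apply, Lp.toTemperedDistribution_apply] at h
    calc ∫ x, g x • (𝓕 (hf2.toLp f) : Lp ℂ 2 (volume : Measure ℝ)) x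
        = ∫ x, (𝓕 G) x • (hf2.toLp f) x := by
          rw [h]; rfl
      _ = ∫ x, (𝓕 G) x • f x := by
          refine integral_congr_ae ?_
          filter_upwards [hf2.coeFn_toLp] with x hx
          rw [hx]
      _ = ∫ x, G x • 𝓕 f x :=
        VectorFourier.integral_fourierIntegral_smul_eq_flip (L := innerₗ ℝ)
            Real.continuous_fourierChar continuous_inner G.integrable hf |>.trans
              (by rw [flip_innerₗ]; rfl)
      _ = _ := rfl

open scoped FourierTransform in
theorem integral_fourier_mul_conj_fourier {f g : ℝ → ℂ} (hf : Integrable f) (hf2 : MemLp f 2)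
    (hg : Integrable g) (hg2 : MemLp g 2) :
    ∫ x, 𝓕 f x * (starRingEnd ℂ) (𝓕 g x) = ∫ x, f x * (starRingEnd ℂ) (g x) := by
  have h := Lp.inner_fourier_eq (hg2.toLp g) (hf2.toLp f)
  rw [L2.inner_def, L2.inner_def] at h
  simp only [RCLike.inner_apply] at h
  calc _ = _ := integral_congr_ae (by
        filter_upwards [coeFn_fourier_toLp_ae_eq hf hf2, coeFn_fourier_toLp_ae_eq hg hg2]
          with x hx hy
        rw [hx, hy])
    _ = _ := h
    _ = _ := integral_congr_ae (by
        filter_upwards [hf2.coeFn_toLp, hg2.coeFn_toLp] with x hx hy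
        rw [hx, hy])

theorem integral_eq_two_mul_setIntegral_Ioi_of_even {f : ℝ → ℂ} (hf : Integrable f)
    (h : ∀ x, f (-x) = f x) : ∫ x, f x = 2 * ∫ x in Set.Ioi (0 : ℝ), f x := by
  rw [← intervalIntegral.integral_Iic_add_Ioi (b := 0) hf.integrableOn hf.integrableOn]
  have := integral_comp_neg_Ioi 0 f
  simp only [h, neg_zero] at this
  rw [← this, two_mul]

theorem setIntegral_Ioi_comp_sq_div_four_pi (g : ℝ → ℂ) :
    ∫ t in Set.Ioi (0 : ℝ), g t =
      ∫ p in Set.Ioi (0 : ℝ), (p / (2 * π)) • g (p ^ 2 / (4 * π)) := by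
  have hp := Real.pi_pos
  have h1 := integral_comp_mul_left_Ioi g 0 (b := (4 * π)⁻¹) (by positivity)
  have h2 := integral_comp_rpow_Ioi_of_pos (g := fun t => g ((4 * π)⁻¹ * t)) two_pos
  rw [mul_zero, inv_inv] at h1
  rw [← h2] at h1
  have h3 : ∫ t in Set.Ioi (0 : ℝ), g t = (4 * π)⁻¹ • ((4 * π) • ∫ t in Set.Ioi (0 : ℝ), g t) := by
    rw [inv_smul_smul₀ (by positivity)]
  rw [h3, ← h1, ← integral_smul]
  refine setIntegral_congr_fun measurableSet_Ioi fun p _ => ?_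
  have e : (4 * π)⁻¹ * p ^ (2 : ℝ) = p ^ 2 / (4 * π) := by
    rw [Real.rpow_two, inv_mul_eq_div]
  have e' : (4 * π)⁻¹ * (2 * p ^ ((2 : ℝ) - 1)) = p / (2 * π) := by
    rw [show (2 : ℝ) - 1 = 1 by norm_num, Real.rpow_one]
    field_simp
    norm_num
  simp only [smul_smul, e, e']

theorem integral_rpow_neg_half_mul_exp_neg_mul_sq {p : ℝ} (hp : 0 < p) :
    ∫ a in Set.Ioi (0 : ℝ), a ^ (-(1 : ℝ) / 2) * Real.exp (-(p ^ 2 * a)) = √π / p := by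
  have h := Real.integral_rpow_mul_exp_neg_mul_Ioi (a := 1 / 2) (r := p ^ 2) (by norm_num)
    (by positivity)
  rw [Real.Gamma_one_half_eq] at h
  norm_num at h ⊢
  rw [h, ← Real.sqrt_eq_rpow, Real.sqrt_inv]
  rw [Real.sqrt_sq hp.le]; field_simp

/-- The function of `t = p² / (4π)` whose Fourier transform is, up to a constant factor, the
transform of an odd function `χ` along the horizontal line at height `a`. -/
noncomputable def fourierProfile (χ : 𝓢(ℝ, ℂ)) (a : ℝ) : ℝ → ℂ :=
  Set.indicator (Set.Ioi 0) fun t => (Real.exp (-(2 * π * a) * t) : ℂ) * χ √(4 * π * t)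

theorem integrable_fourierProfile (χ : 𝓢(ℝ, ℂ)) {a : ℝ} (ha : 0 < a) :
    Integrable (fourierProfile χ a) := by
  set C := ‖χ.toBoundedContinuousFunction‖
  have hC : ∀ p, ‖χ p‖ ≤ C := χ.toBoundedContinuousFunction.norm_coe_le_norm
  refine IntegrableOn.integrable_indicator ?_ measurableSet_Ioi
  refine Integrable.mul_bdd (c := C) ?_ ?_ ?_
  · exact (integrableOn_exp_mul_Ioi (by have := Real.pi_pos; nlinarith [mul_pos this ha]) 0).ofReal
  · exact (χ.continuous.comp (by fun_prop)).aestronglyMeasurable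
  · exact Filter.Eventually.of_forall fun t => hC _

theorem memLp_two_fourierProfile (χ : 𝓢(ℝ, ℂ)) {a : ℝ} (ha : 0 < a) :
    MemLp (fourierProfile χ a) 2 := by
  set C := ‖χ.toBoundedContinuousFunction‖
  have hC : ∀ p, ‖χ p‖ ≤ C := χ.toBoundedContinuousFunction.norm_coe_le_norm
  have hi := integrable_fourierProfile χ ha
  have hb : ∀ t, ‖fourierProfile χ a t‖ ≤ C := by
    intro t
    by_cases ht : t ∈ Set.Ioi (0 : ℝ)
    · rw [fourierProfile, Set.indicator_of_mem ht, norm_mul, Complex.norm_real, Real.norm_eq_abs,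
        Real.abs_exp]
      have : Real.exp (-(2 * π * a) * t) ≤ 1 := by
        rw [Real.exp_le_one_iff, neg_mul, neg_nonpos]
        have := Real.pi_pos
        have : 0 < t := ht
        positivity
      nlinarith [norm_nonneg (χ √(4 * π * t)), hC √(4 * π * t)]
    · rw [fourierProfile, Set.indicator_of_notMem ht, norm_zero]
      exact (norm_nonneg _).trans (hC 0)
  rw [memLp_two_iff_integrable_sq_norm hi.aestronglyMeasurable]
  simp_rw [sq]
  exact hi.norm.mul_bdd (c := C) hi.norm.aestronglyMeasurable
    (Filter.Eventually.of_forall fun t => by simpa using hb t)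

open scoped FourierTransform in
theorem integral_mul_exp_mul_odd_eq_fourier (χ : 𝓢(ℝ, ℂ)) (hχ : ∀ p : ℝ, χ (-p) = -χ p)
    {a : ℝ} (ha : 0 < a) (b : ℝ) :
    ∫ p : ℝ, (p : ℂ) * Complex.exp (Complex.I * (b + a * Complex.I) * (p : ℂ) ^ 2 / 2) * χ p
      = 4 * π * 𝓕 (fourierProfile χ a) (-b) := by
  have hpi := Real.pi_pos
  rw [integral_eq_two_mul_setIntegral_Ioi_of_even]
  · rw [Real.fourier_real_eq_integral_exp_smul]
    have : ∀ t : ℝ, Complex.exp (↑(-2 * π * t * -b) * Complex.I) • fourierProfile χ a t =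
        Set.indicator (Set.Ioi 0) (fun t : ℝ => Complex.exp (↑(-2 * π * t * -b) * Complex.I) *
          ((Real.exp (-(2 * π * a) * t) : ℂ) * χ √(4 * π * t))) t := by
      intro t
      by_cases ht : t ∈ Set.Ioi (0 : ℝ) <;> simp [fourierProfile, ht]
    simp_rw [this]
    rw [integral_indicator measurableSet_Ioi]
    conv_rhs => rw [setIntegral_Ioi_comp_sq_div_four_pi]
    rw [← integral_const_mul, ← integral_const_mul]
    refine setIntegral_congr_fun measurableSet_Ioi fun p hp => ?_
    have e : 4 * π * (p ^ 2 / (4 * π)) = p ^ 2 := by field_simp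
    have hπ : (π : ℂ) ≠ 0 := by exact_mod_cast hpi.ne'
    simp only [e, Real.sqrt_sq (le_of_lt hp), Complex.real_smul]
    rw [← mul_assoc (Complex.exp _), Complex.ofReal_exp, ← Complex.exp_add]
    have e2 : ((-2 * π * (p ^ 2 / (4 * π)) * -b : ℝ) : ℂ) * Complex.I +
        ((-(2 * π * a) * (p ^ 2 / (4 * π)) : ℝ) : ℂ) =
        Complex.I * (b + a * Complex.I) * (p : ℂ) ^ 2 / 2 := by
      push_cast
      field_simp
      linear_combination (-4 * (p : ℂ) ^ 2 * (a : ℂ)) * Complex.I_sq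
    rw [e2]
    push_cast
    field_simp
    ring
  · have hi : Integrable fun p : ℝ => (p : ℂ) * χ p := by
      have := χ.integrable_pow_mul volume 1
      refine (integrable_norm_iff ?_).1 ?_
      · exact (Complex.continuous_ofReal.mul χ.continuous).aestronglyMeasurable
      · simpa using this
    have := hi.mul_bdd (g := fun p : ℝ =>
      Complex.exp (Complex.I * (b + a * Complex.I) * (p : ℂ) ^ 2 / 2)) (c := 1)
      (Continuous.aestronglyMeasurable (by fun_prop)) (Filter.Eventually.of_forall fun p => ?_)
    · refine this.congr (Filter.Eventually.of_forall fun p => ?_)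
      simp only
      ring
    · rw [Complex.norm_exp, Real.exp_le_one_iff]
      have : (Complex.I * (b + a * Complex.I) * (p : ℂ) ^ 2 / 2).re = -(a * p ^ 2 / 2) := by
        rw [show (Complex.I * (b + a * Complex.I) * (p : ℂ) ^ 2 / 2) =
          ((-(a * p ^ 2 / 2) : ℝ) : ℂ) + ((b * p ^ 2 / 2 : ℝ) : ℂ) * Complex.I by
            push_cast; linear_combination (a * (p : ℂ) ^ 2 / 2) * Complex.I_sq]
        simp only [Complex.add_re, Complex.ofReal_re, Complex.re_ofReal_mul, Complex.I_re, mul_zero,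
          add_zero]
      rw [this, neg_nonpos]
      positivity
  · intro p
    rw [hχ]
    push_cast
    ring_nf

theorem integral_fourierProfile_mul_conj (φ ψ : 𝓢(ℝ, ℂ)) (a : ℝ) :
    ∫ t, fourierProfile φ a t * (starRingEnd ℂ) (fourierProfile ψ a t) =
      ∫ p in Set.Ioi (0 : ℝ),
        ((p / (2 * π) * Real.exp (-(p ^ 2 * a)) : ℝ) : ℂ) * (φ p * (starRingEnd ℂ) (ψ p)) := by
  have hpi := Real.pi_pos
  have : ∀ t : ℝ, fourierProfile φ a t * (starRingEnd ℂ) (fourierProfile ψ a t) =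
      Set.indicator (Set.Ioi 0) (fun t : ℝ => ((Real.exp (-(2 * π * a) * t) : ℂ) * φ √(4 * π * t)) *
        (starRingEnd ℂ) ((Real.exp (-(2 * π * a) * t) : ℂ) * ψ √(4 * π * t))) t := by
    intro t
    by_cases ht : t ∈ Set.Ioi (0 : ℝ) <;> simp [fourierProfile, ht]
  simp_rw [this]
  rw [integral_indicator measurableSet_Ioi, setIntegral_Ioi_comp_sq_div_four_pi]
  refine setIntegral_congr_fun measurableSet_Ioi fun p hp => ?_
  have e : 4 * π * (p ^ 2 / (4 * π)) = p ^ 2 := by field_simp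
  have e2 : -(p ^ 2 * a) = -(2 * π * a) * (p ^ 2 / (4 * π)) + -(2 * π * a) * (p ^ 2 / (4 * π)) := by
    field_simp; ring
  simp only [e, Real.sqrt_sq (le_of_lt hp), Complex.real_smul, map_mul, Complex.conj_ofReal]
  rw [e2, Real.exp_add]
  push_cast
  ring

theorem integrable_schwartz_mul_conj (φ ψ : 𝓢(ℝ, ℂ)) :
    Integrable fun p => φ p * (starRingEnd ℂ) (ψ p) := by
  set C := ‖ψ.toBoundedContinuousFunction‖
  have hC : ∀ p, ‖ψ p‖ ≤ C := ψ.toBoundedContinuousFunction.norm_coe_le_norm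
  exact φ.integrable.mul_bdd (c := C)
    (Complex.continuous_conj.comp ψ.continuous).aestronglyMeasurable
    (Filter.Eventually.of_forall fun p => by
      rw [RCLike.norm_conj]; exact hC _)

theorem integral_rpow_mul_integral_exp_eq {h : ℝ → ℂ} (hc : Continuous h) (hi : Integrable h) :
    ∫ a in Set.Ioi (0 : ℝ), ∫ p in Set.Ioi (0 : ℝ),
      ((a ^ (-(1 : ℝ) / 2) * (p * Real.exp (-(p ^ 2 * a))) : ℝ) : ℂ) * h p =
    √π * ∫ p in Set.Ioi (0 : ℝ), h p := by
  have key : ∀ p ∈ Set.Ioi (0 : ℝ), ∫ a in Set.Ioi (0 : ℝ),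
      a ^ (-(1 : ℝ) / 2) * (p * Real.exp (-(p ^ 2 * a))) = √π := by
    intro p hp
    have := integral_rpow_neg_half_mul_exp_neg_mul_sq hp
    simp_rw [mul_left_comm _ p, integral_const_mul, this]
    have : p ≠ 0 := ne_of_gt hp
    field_simp
  rw [integral_integral_swap, ← integral_const_mul]
  · refine setIntegral_congr_fun measurableSet_Ioi fun p hp => ?_
    rw [integral_mul_const, integral_complex_ofReal, key p hp]
  · rw [integrable_prod_iff']
    · have hae : ∀ᵐ p ∂volume.restrict (Set.Ioi (0 : ℝ)), p ∈ Set.Ioi (0 : ℝ) :=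
        ae_restrict_mem measurableSet_Ioi
      constructor
      · filter_upwards [hae] with p hp
        have hne : ∫ a in Set.Ioi (0 : ℝ), a ^ (-(1 : ℝ) / 2) * (p * Real.exp (-(p ^ 2 * a))) ≠ 0 := by
          rw [key p hp]
          exact (Real.sqrt_pos.2 Real.pi_pos).ne'
        exact (Integrable.of_integral_ne_zero hne).ofReal (𝕜 := ℂ) |>.mul_const (h p)
      · refine Integrable.congr (f := fun p => √π * ‖h p‖)
          (hi.norm.const_mul _).integrableOn ?_
        filter_upwards [hae] with p hp
        simp only [Function.uncurry_apply_pair, norm_mul, Complex.norm_real]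
        rw [integral_mul_const, ← key p hp]
        congr 1
        refine setIntegral_congr_fun measurableSet_Ioi fun a ha => ?_
        have ha' : 0 < a := ha
        have hp' : 0 < p := hp
        simp only [Real.norm_eq_abs]
        rw [← abs_mul, ← abs_mul, abs_of_nonneg (by positivity)]
    · have : Measurable h := hc.measurable
      exact Measurable.aestronglyMeasurable (by unfold Function.uncurry; fun_prop)

open scoped FourierTransform in
theorem Ao_isometry (φ ψ : SchwartzMap ℝ ℂ)
    (hφ : ∀ p : ℝ, φ (-p) = -φ p) (hψ : ∀ p : ℝ, ψ (-p) = -ψ p)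
    (Ao : (SchwartzMap ℝ ℂ) → ℂ → ℂ)
    (hAo : ∀ χ : SchwartzMap ℝ ℂ, ∀ z : ℂ, 0 < z.im →
      Ao χ z = (1 / (2 * (Real.pi : ℂ) ^ ((3 : ℂ) / 4))) *
        ∫ p : ℝ, (p : ℂ) * Complex.exp (Complex.I * z * (p : ℂ) ^ 2 / 2) * χ p) :
    (∫ a in Set.Ioi (0 : ℝ), ∫ b : ℝ,
        Ao φ (b + a * Complex.I) * (starRingEnd ℂ) (Ao ψ (b + a * Complex.I)) *
          ((a ^ (-(1 : ℝ) / 2) : ℝ) : ℂ))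
      = ∫ p : ℝ, φ p * (starRingEnd ℂ) (ψ p) := by
  have hpi := Real.pi_pos
  have hA : ∀ χ : 𝓢(ℝ, ℂ), (∀ p : ℝ, χ (-p) = -χ p) → ∀ a : ℝ, 0 < a → ∀ b : ℝ,
      Ao χ (b + a * Complex.I) =
        ((2 * π ^ (1 / 4 : ℝ) : ℝ) : ℂ) * 𝓕 (fourierProfile χ a) (-b) := by
    intro χ hχ a ha b
    rw [hAo χ _ (by simpa using ha), integral_mul_exp_mul_odd_eq_fourier χ hχ ha, ← mul_assoc]
    congr 1
    have h1 : (π : ℂ) ^ ((3 : ℂ) / 4) = ((π ^ (3 / 4 : ℝ) : ℝ) : ℂ) := by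
      rw [Complex.ofReal_cpow hpi.le]
      norm_num
    have h2 : π ^ (1 / 4 : ℝ) * π ^ (3 / 4 : ℝ) = π := by
      rw [← Real.rpow_add hpi]
      norm_num
    have h3 : π ^ (3 / 4 : ℝ) ≠ 0 := by positivity
    rw [h1]
    norm_cast
    rw [div_mul_eq_mul_div, div_eq_iff (by positivity)]
    linear_combination (-4) * h2
  have hb : ∀ a ∈ Set.Ioi (0 : ℝ), ∫ b : ℝ,
        Ao φ (b + a * Complex.I) * (starRingEnd ℂ) (Ao ψ (b + a * Complex.I)) *
          ((a ^ (-(1 : ℝ) / 2) : ℝ) : ℂ) = ((2 / √π : ℝ) : ℂ) * ∫ p in Set.Ioi (0 : ℝ),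
      ((a ^ (-(1 : ℝ) / 2) * (p * Real.exp (-(p ^ 2 * a))) : ℝ) : ℂ) *
        (φ p * (starRingEnd ℂ) (ψ p)) := by
    intro a ha
    have hP := integral_fourier_mul_conj_fourier (integrable_fourierProfile φ ha)
      (memLp_two_fourierProfile φ ha) (integrable_fourierProfile ψ ha)
      (memLp_two_fourierProfile ψ ha)
    rw [integral_fourierProfile_mul_conj, ← integral_neg_eq_self] at hP
    have hs : (2 * π ^ (1 / 4 : ℝ)) * (2 * π ^ (1 / 4 : ℝ)) = 4 * √π := by
      rw [Real.sqrt_eq_rpow, mul_mul_mul_comm, ← Real.rpow_add hpi]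
      norm_num
    calc _ = ∫ b : ℝ, ((4 * √π * a ^ (-(1 : ℝ) / 2) : ℝ) : ℂ) *
          (𝓕 (fourierProfile φ a) (-b) * (starRingEnd ℂ) (𝓕 (fourierProfile ψ a) (-b))) := by
          congr 1 with b
          rw [hA φ hφ a ha, hA ψ hψ a ha, ← hs, map_mul, Complex.conj_ofReal]
          push_cast
          ring
      _ = _ := by
          rw [integral_const_mul, hP, ← integral_const_mul, ← integral_const_mul]
          congr 1 with p
          rw [← mul_assoc (Complex.ofReal _), ← mul_assoc (Complex.ofReal _), ← Complex.ofReal_mul,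
            ← Complex.ofReal_mul]
          congr 2
          have : √π * √π = π := Real.mul_self_sqrt hpi.le
          have : √π ≠ 0 := by positivity
          field_simp
          rw [Real.sq_sqrt hpi.le]
          ring
  rw [setIntegral_congr_fun measurableSet_Ioi hb, integral_const_mul,
    integral_rpow_mul_integral_exp_eq (h := fun p => φ p * (starRingEnd ℂ) (ψ p))
      (φ.continuous.mul (Complex.continuous_conj.comp ψ.continuous))
      (integrable_schwartz_mul_conj φ ψ),
    integral_eq_two_mul_setIntegral_Ioi_of_even (integrable_schwartz_mul_conj φ ψ)
      (fun p => by simp [hφ, hψ]), ← mul_assoc, ← Complex.ofReal_mul,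
    div_mul_cancel₀ _ (by positivity), Complex.ofReal_ofNat]
end

section
/- Let φ and ψ be even Schwartz functions on ℝ with complex values, and define (A_eχ)(z) = (1/(√2 · π^{3/4})) ∫_ℝ p² · e^{i z p²/2} · χ(p) dp for Im z > 0. Then ∫_0^∞ ∫_ℝ (A_eφ)(b + i a) · conj((A_eψ)(b + i a)) · a^{1/2} db da = ∫_ℝ φ(p) · conj(ψ(p)) dp; i.e., A_e is an isometry from the even Schwartz functions (with the L²(ℝ) inner product) into the space H_{1/2} of analytic functions on the upper half-plane square-integrable with respect to dμ_{1/2}(z) = (Im z)^{1/2} dA(z). -/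
open MeasureTheory Complex Real SchwartzMap

open scoped FourierTransform ContDiff ComplexConjugate

section Plancherel

variable {E : Type*} [NormedAddCommGroup E] [InnerProductSpace ℝ E] [FiniteDimensional ℝ E]
  [MeasurableSpace E] [BorelSpace E]

/-- The `L²` Fourier transform of a function in `L¹ ∩ L²` is given by the Fourier integral. -/
theorem MeasureTheory.MemLp.coeFn_fourier_toLp {f : E → ℂ} (hf₁ : Integrable f)
    (hf₂ : MemLp f 2) : (𝓕 (hf₂.toLp f) : Lp ℂ 2 (volume : Measure E)) =ᵐ[volume] 𝓕 f := by
  have hcont : Continuous (𝓕 f) :=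
    VectorFourier.fourierIntegral_continuous Real.continuous_fourierChar continuous_inner hf₁
  refine ae_eq_of_integral_contDiff_smul_eq
    ((Lp.memLp _).locallyIntegrable (by norm_num)) hcont.locallyIntegrable fun g hg hgc ↦ ?_
  have hg₁ : HasCompactSupport (Complex.ofRealCLM ∘ g) := hgc.comp_left rfl
  have hg₂ : ContDiff ℝ ∞ (Complex.ofRealCLM ∘ g) := by fun_prop
  set G : 𝓢(E, ℂ) := hg₁.toSchwartzMap hg₂
  have hG (x : E) : G x = (g x : ℂ) := rfl
  calc ∫ x, g x • (𝓕 (hf₂.toLp f) : Lp ℂ 2 (volume : Measure E)) x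
      = Lp.toTemperedDistribution (μ := volume) (𝓕 (hf₂.toLp f) : Lp ℂ 2 (volume : Measure E)) G := by
        simp [hG, Lp.toTemperedDistribution_apply]
    _ = Lp.toTemperedDistribution (μ := volume) (hf₂.toLp f) (𝓕 G) := by
        rw [← Lp.fourier_toTemperedDistribution_eq, TemperedDistribution.fourier_apply]
    _ = ∫ x, 𝓕 (G : E → ℂ) x • f x := by
        rw [Lp.toTemperedDistribution_apply]
        refine integral_congr_ae ?_
        filter_upwards [hf₂.coeFn_toLp] with x hx
        rw [hx, SchwartzMap.fourier_coe]
    _ = ∫ x, G x • 𝓕 f x := by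
        simpa using! (VectorFourier.integral_fourierIntegral_smul_eq_flip (L := innerₗ E)
          Real.continuous_fourierChar continuous_inner G.integrable hf₁)
    _ = ∫ x, g x • 𝓕 f x := by simp [hG]

/-- Plancherel's theorem for functions in `L¹ ∩ L²`. -/
theorem integral_fourier_mul_conj_fourier_s8 {f g : E → ℂ} (hf₁ : Integrable f) (hf₂ : MemLp f 2)
    (hg₁ : Integrable g) (hg₂ : MemLp g 2) :
    ∫ w, 𝓕 f w * conj (𝓕 g w) = ∫ x, f x * conj (g x) := by
  have key := Lp.inner_fourier_eq (hg₂.toLp g) (hf₂.toLp f)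
  rw [L2.inner_def, L2.inner_def] at key
  convert key using 1 <;> refine integral_congr_ae ?_
  · filter_upwards [hf₂.coeFn_fourier_toLp hf₁, hg₂.coeFn_fourier_toLp hg₁] with x hx hy
    rw [hx, hy]; simp
  · filter_upwards [hf₂.coeFn_toLp, hg₂.coeFn_toLp] with x hx hy
    rw [hx, hy]; simp

end Plancherel

/-- The integral of an even integrable function is twice its integral over the half-line. -/
theorem integral_eq_two_mul_integral_Ioi_of_even {f : ℝ → ℂ} (hf : Integrable f)
    (heven : ∀ x, f (-x) = f x) : ∫ x, f x = 2 * ∫ x in Set.Ioi 0, f x := by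
  rw [← intervalIntegral.integral_Iic_add_Ioi (b := 0) hf.integrableOn hf.integrableOn, two_mul]
  congr 1
  simpa [heven] using (integral_comp_neg_Ioi 0 f).symm

theorem integral_Ioi_comp_sqrt (g : ℝ → ℂ) :
    ∫ u in Set.Ioi (0 : ℝ), ((2 * √u)⁻¹ : ℝ) • g √u = ∫ p in Set.Ioi (0 : ℝ), g p := by
  rw [← integral_comp_rpow_Ioi_of_pos (g := g) (p := 1 / 2) (by norm_num)]
  refine setIntegral_congr_fun measurableSet_Ioi fun u hu ↦ ?_
  have hu : 0 < u := hu
  simp only [Real.sqrt_eq_rpow]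
  rw [show (1 / 2 - 1 : ℝ) = -(1 / 2) by norm_num, Real.rpow_neg hu.le, mul_inv, one_div]

theorem integral_rpow_half_mul_exp_neg_mul {r : ℝ} (hr : 0 < r) :
    ∫ a in Set.Ioi (0 : ℝ), a ^ ((1 : ℝ) / 2) * Real.exp (-(a * r)) = √π / (2 * (r * √r)) := by
  have h := Real.integral_rpow_mul_exp_neg_mul_Ioi (a := 3 / 2) (by norm_num) hr
  have hG : Real.Gamma (3 / 2) = √π / 2 := by
    rw [show (3 / 2 : ℝ) = 1 / 2 + 1 by norm_num, Real.Gamma_add_one (by norm_num),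
      Real.Gamma_one_half_eq]
    ring
  have hp : (1 / r) ^ (3 / 2 : ℝ) = (r * √r)⁻¹ := by
    rw [one_div, Real.inv_rpow hr.le, show (3 / 2 : ℝ) = 1 + 1 / 2 by norm_num,
      Real.rpow_add hr, Real.rpow_one, Real.sqrt_eq_rpow]
  rw [hG, hp, show (3 / 2 - 1 : ℝ) = 1 / 2 by norm_num] at h
  simp_rw [mul_comm r] at h
  rw [h]
  ring

/-- The density on the half-line, in the variable `u = p ^ 2`, whose Fourier transform is
`b ↦ ∫ p, p ^ 2 * exp (I * (b + a * I) * p ^ 2 / 2) * χ p` up to rescaling. -/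
noncomputable def halfLineDensity (χ : 𝓢(ℝ, ℂ)) (a : ℝ) : ℝ → ℂ :=
  (Set.Ioi 0).indicator fun u ↦ ((√u * Real.exp (-(a / 2) * u) : ℝ) : ℂ) * χ √u

theorem aestronglyMeasurable_halfLineDensity (χ : 𝓢(ℝ, ℂ)) (a : ℝ) :
    AEStronglyMeasurable (halfLineDensity χ a) := by
  refine (Continuous.aestronglyMeasurable ?_).indicator measurableSet_Ioi
  have := χ.continuous
  fun_prop

theorem exists_norm_halfLineDensity_le (χ : 𝓢(ℝ, ℂ)) (a : ℝ) :
    ∃ C, ∀ u, ‖halfLineDensity χ a u‖ ≤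
      (Set.Ioi 0).indicator (fun u ↦ C * Real.exp (-(a / 2) * u)) u := by
  obtain ⟨C, -, hC⟩ := χ.decay 1 0
  refine ⟨C, fun u ↦ ?_⟩
  rw [halfLineDensity, norm_indicator_eq_indicator_norm]
  refine Set.indicator_le_indicator ?_
  have h := hC √u
  simp only [norm_iteratedFDeriv_zero, pow_one, Real.norm_eq_abs, abs_of_nonneg (Real.sqrt_nonneg u)]
    at h
  rw [norm_mul, Complex.norm_real, Real.norm_of_nonneg (by positivity), mul_right_comm]
  gcongr

theorem integrable_halfLineDensity (χ : 𝓢(ℝ, ℂ)) {a : ℝ} (ha : 0 < a) :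
    Integrable (halfLineDensity χ a) := by
  obtain ⟨C, hC⟩ := exists_norm_halfLineDensity_le χ a
  refine Integrable.mono' ?_ (aestronglyMeasurable_halfLineDensity χ a) (.of_forall hC)
  rw [integrable_indicator_iff measurableSet_Ioi]
  exact (exp_neg_integrableOn_Ioi 0 (half_pos ha)).const_mul C

theorem memLp_two_halfLineDensity (χ : 𝓢(ℝ, ℂ)) {a : ℝ} (ha : 0 < a) :
    MemLp (halfLineDensity χ a) 2 := by
  obtain ⟨C, hC⟩ := exists_norm_halfLineDensity_le χ a
  rw [memLp_two_iff_integrable_sq_norm (aestronglyMeasurable_halfLineDensity χ a)]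
  simp_rw [sq]
  refine (integrable_halfLineDensity χ ha).norm.bdd_mul (c := |C|)
    (aestronglyMeasurable_halfLineDensity χ a).norm (.of_forall fun u ↦ ?_)
  rw [norm_norm]
  refine (hC u).trans (Set.indicator_apply_le' (fun hu ↦ ?_) fun _ ↦ abs_nonneg C)
  have hu : 0 < u := hu
  calc C * Real.exp (-(a / 2) * u) ≤ |C| * 1 := by
        gcongr
        · exact le_abs_self C
        · rw [Real.exp_le_one_iff]
          have : 0 < a / 2 * u := by positivity
          linarith
    _ = |C| := mul_one _

theorem integral_sq_mul_cexp_mul_eq_fourier (χ : 𝓢(ℝ, ℂ)) (hχ : ∀ p, χ (-p) = χ p) {a : ℝ}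
    (ha : 0 < a) (b : ℝ) :
    ∫ p : ℝ, (p : ℂ) ^ 2 * Complex.exp (Complex.I * (b + a * Complex.I) * (p : ℂ) ^ 2 / 2) * χ p =
      𝓕 (halfLineDensity χ a) (-(4 * π)⁻¹ * b) := by
  have hint : Integrable fun p : ℝ ↦
      (p : ℂ) ^ 2 * Complex.exp (Complex.I * (b + a * Complex.I) * (p : ℂ) ^ 2 / 2) * χ p := by
    refine (χ.integrable_pow_mul volume 2).mono' ?_ (.of_forall fun p ↦ ?_)
    · have := χ.continuous
      exact Continuous.aestronglyMeasurable (by fun_prop)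
    · rw [norm_mul, norm_mul, norm_pow, Complex.norm_real, Complex.norm_exp]
      have : (Complex.I * (b + a * Complex.I) * (p : ℂ) ^ 2 / 2).re = -(a * p ^ 2 / 2) := by
        rw [show Complex.I * (b + a * Complex.I) * (p : ℂ) ^ 2 / 2 =
          ((-(a * p ^ 2 / 2) : ℝ) : ℂ) + ((b * p ^ 2 / 2 : ℝ) : ℂ) * Complex.I by
            push_cast; linear_combination (a * p ^ 2 / 2 : ℂ) * Complex.I_sq]
        rw [Complex.add_re, Complex.re_ofReal_mul, Complex.I_re, Complex.ofReal_re, mul_zero,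
          add_zero]
      rw [this]
      have hle : Real.exp (-(a * p ^ 2 / 2)) ≤ 1 := by
        rw [Real.exp_le_one_iff]
        have : 0 ≤ a * p ^ 2 / 2 := by positivity
        linarith
      gcongr
      exact mul_le_of_le_one_right (by positivity) hle
  rw [integral_eq_two_mul_integral_Ioi_of_even hint (by simp [hχ]), ← integral_Ioi_comp_sqrt,
    Real.fourier_eq', ← integral_const_mul]
  have hind : ∀ v : ℝ, Complex.exp (↑(-2 * π * inner ℝ v (-(4 * π)⁻¹ * b)) * Complex.I) •
      halfLineDensity χ a v = (Set.Ioi 0).indicator (fun v : ℝ ↦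
        Complex.exp (↑(-2 * π * inner ℝ v (-(4 * π)⁻¹ * b)) * Complex.I) •
        (((√v * Real.exp (-(a / 2) * v) : ℝ) : ℂ) * χ √v)) v := fun v ↦ by
    rw [halfLineDensity, Set.indicator_smul_apply]
  simp_rw [hind]
  rw [integral_indicator measurableSet_Ioi]
  refine setIntegral_congr_fun measurableSet_Ioi fun u hu ↦ ?_
  have hu : 0 < u := hu
  have hs : ((√u : ℝ) : ℂ) ^ 2 = u := by exact_mod_cast Real.sq_sqrt hu.le
  have hs0 : ((√u : ℝ) : ℂ) ≠ 0 := by exact_mod_cast (Real.sqrt_pos.2 hu).ne'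
  have hexp : Complex.exp (Complex.I * (b + a * Complex.I) * u / 2) =
      Complex.exp (↑(-2 * π * inner ℝ u (-(4 * π)⁻¹ * b)) * Complex.I) *
        Complex.exp (-(a / 2) * u) := by
    rw [← Complex.exp_add]
    congr 1
    have : (π : ℂ) ≠ 0 := by exact_mod_cast Real.pi_ne_zero
    simp
    field_simp
    linear_combination (4 * a * u : ℂ) * Complex.I_sq
  simp only [smul_eq_mul, Complex.real_smul]
  rw [hs, hexp]
  push_cast
  generalize Complex.exp (-(a / 2) * u) = e
  rw [← hs]
  field_simp

theorem integral_integral_rpow_half_mul_exp {h : ℝ → ℂ} (hh : Integrable h) :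
    ∫ a in Set.Ioi (0 : ℝ), ∫ p in Set.Ioi (0 : ℝ),
        ((a ^ ((1 : ℝ) / 2) * Real.exp (-(a * p ^ 2)) : ℝ) : ℂ) * ((p ^ 3 : ℝ) * h p) =
      ((√π / 2 : ℝ) : ℂ) * ∫ p in Set.Ioi (0 : ℝ), h p := by
  have hgamma {p : ℝ} (hp : 0 < p) :
      ∫ a in Set.Ioi (0 : ℝ), a ^ ((1 : ℝ) / 2) * Real.exp (-(a * p ^ 2)) = √π / 2 / p ^ 3 := by
    rw [integral_rpow_half_mul_exp_neg_mul (by positivity), Real.sqrt_sq hp.le]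
    field_simp
  have hintegrable {p : ℝ} (hp : 0 < p) :
      IntegrableOn (fun a ↦ a ^ ((1 : ℝ) / 2) * Real.exp (-(a * p ^ 2))) (Set.Ioi 0) :=
    Integrable.of_integral_ne_zero (by rw [hgamma hp]; positivity)
  rw [integral_integral_swap, ← integral_const_mul]
  · refine setIntegral_congr_fun measurableSet_Ioi fun p hp ↦ ?_
    have hp : 0 < p := hp
    have hp' : (p : ℂ) ≠ 0 := by exact_mod_cast hp.ne'
    rw [integral_mul_const, integral_complex_ofReal, hgamma hp]
    push_cast
    field_simp
  · rw [integrable_prod_iff']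
    · constructor
      · filter_upwards [ae_restrict_mem measurableSet_Ioi] with p hp
        exact (hintegrable hp).ofReal.mul_const ((p ^ 3 : ℝ) * h p)
      · refine (hh.integrableOn.norm.const_mul (√π / 2)).congr ?_
        filter_upwards [ae_restrict_mem measurableSet_Ioi] with p hp
        have hp : 0 < p := hp
        have : ∀ a ∈ Set.Ioi (0 : ℝ), ‖Function.uncurry (fun a p : ℝ ↦
            ((a ^ ((1 : ℝ) / 2) * Real.exp (-(a * p ^ 2)) : ℝ) : ℂ) * ((p ^ 3 : ℝ) * h p)) (a, p)‖ =
            a ^ ((1 : ℝ) / 2) * Real.exp (-(a * p ^ 2)) * (p ^ 3 * ‖h p‖) := fun a ha ↦ by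
          have ha : 0 < a := ha
          rw [Function.uncurry_apply_pair, norm_mul, norm_mul, Complex.norm_real,
            Complex.norm_real, Real.norm_of_nonneg (by positivity),
            Real.norm_of_nonneg (by positivity)]
        rw [setIntegral_congr_fun measurableSet_Ioi this, integral_mul_const, hgamma hp]
        field_simp
    · have h1 : AEStronglyMeasurable (fun x : ℝ × ℝ ↦ h x.2)
          ((volume.restrict (Set.Ioi 0)).prod (volume.restrict (Set.Ioi 0))) :=
        hh.integrableOn.aestronglyMeasurable.comp_snd
      have h2 : Measurable fun x : ℝ × ℝ ↦
          ((x.1 ^ ((1 : ℝ) / 2) * Real.exp (-(x.1 * x.2 ^ 2)) : ℝ) : ℂ) := by fun_prop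
      have h3 : Measurable fun x : ℝ × ℝ ↦ ((x.2 ^ 3 : ℝ) : ℂ) := by fun_prop
      exact h2.aestronglyMeasurable.mul (h3.aestronglyMeasurable.mul h1)

theorem integral_halfLineDensity_mul_conj (φ ψ : 𝓢(ℝ, ℂ)) (a : ℝ) :
    ∫ u, halfLineDensity φ a u * conj (halfLineDensity ψ a u) =
      2 * ∫ p in Set.Ioi (0 : ℝ), (Real.exp (-(a * p ^ 2)) : ℂ) *
        ((p ^ 3 : ℝ) * (φ p * conj (ψ p))) := by
  have hind : ∀ u, halfLineDensity φ a u * conj (halfLineDensity ψ a u) =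
      (Set.Ioi 0).indicator (fun u : ℝ ↦ (u : ℂ) * Real.exp (-(a * u)) *
        (φ √u * conj (ψ √u))) u := fun u ↦ by
    by_cases hu : 0 < u
    · have hs : ((√u : ℝ) : ℂ) * (√u : ℝ) = u := by exact_mod_cast Real.mul_self_sqrt hu.le
      have he : Real.exp (-(a * u)) = Real.exp (-(a / 2) * u) * Real.exp (-(a / 2) * u) := by
        rw [← Real.exp_add]; ring_nf
      simp only [halfLineDensity, Set.indicator_of_mem (Set.mem_Ioi.2 hu), map_mul,
        Complex.conj_ofReal, he, ← hs, Complex.ofReal_mul]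
      ring
    · simp [halfLineDensity, hu]
  simp_rw [hind]
  rw [integral_indicator measurableSet_Ioi, ← integral_Ioi_comp_sqrt fun p : ℝ ↦
    (Real.exp (-(a * p ^ 2)) : ℂ) * ((p ^ 3 : ℝ) * (φ p * conj (ψ p))), ← integral_const_mul]
  refine setIntegral_congr_fun measurableSet_Ioi fun u hu ↦ ?_
  have hu : 0 < u := hu
  have hs : ((√u : ℝ) : ℂ) ^ 2 = u := by exact_mod_cast Real.sq_sqrt hu.le
  have hs0 : ((√u : ℝ) : ℂ) ≠ 0 := by exact_mod_cast (Real.sqrt_pos.2 hu).ne'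
  simp only [Complex.real_smul, Real.sq_sqrt hu.le]
  push_cast
  generalize Complex.exp (-(a * u)) = e
  rw [← hs]
  field_simp

theorem Ae_isometry (φ ψ : SchwartzMap ℝ ℂ)
    (hφ : ∀ p : ℝ, φ (-p) = φ p) (hψ : ∀ p : ℝ, ψ (-p) = ψ p)
    (Ae : (SchwartzMap ℝ ℂ) → ℂ → ℂ)
    (hAe : ∀ χ : SchwartzMap ℝ ℂ, ∀ z : ℂ, 0 < z.im →
      Ae χ z = (1 / (Real.sqrt 2 * (Real.pi : ℂ) ^ ((3 : ℂ) / 4))) *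
        ∫ p : ℝ, (p : ℂ) ^ 2 * Complex.exp (Complex.I * z * (p : ℂ) ^ 2 / 2) * χ p) :
    (∫ a in Set.Ioi (0 : ℝ), ∫ b : ℝ,
        Ae φ (b + a * Complex.I) * (starRingEnd ℂ) (Ae ψ (b + a * Complex.I)) *
          ((a ^ ((1 : ℝ) / 2) : ℝ) : ℂ))
      = ∫ p : ℝ, φ p * (starRingEnd ℂ) (ψ p) := by
  have hc : (1 / (Real.sqrt 2 * (Real.pi : ℂ) ^ ((3 : ℂ) / 4))) =
      (((√2 * π ^ ((3 : ℝ) / 4))⁻¹ : ℝ) : ℂ) := by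
    rw [one_div]
    push_cast
    rw [Complex.ofReal_cpow Real.pi_pos.le]
    norm_num
  set c : ℝ := (√2 * π ^ ((3 : ℝ) / 4))⁻¹ with hcdef
  have hcsq : c ^ 2 * (2 * π * √π) = 1 := by
    have h1 : (π ^ ((3 : ℝ) / 4)) ^ 2 = π * √π := by
      rw [← Real.rpow_natCast, ← Real.rpow_mul Real.pi_pos.le, Real.sqrt_eq_rpow,
        ← Real.rpow_one_add' Real.pi_pos.le (by norm_num)]
      norm_num
    rw [hcdef, inv_pow, mul_pow, Real.sq_sqrt (by norm_num), h1]
    have := Real.pi_pos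
    field_simp
  have hAe' (χ : 𝓢(ℝ, ℂ)) (hχ : ∀ p, χ (-p) = χ p) {a : ℝ} (ha : 0 < a) (b : ℝ) :
      Ae χ (b + a * Complex.I) = c * 𝓕 (halfLineDensity χ a) (-(4 * π)⁻¹ * b) := by
    rw [hAe χ _ (by simpa using ha), hc, integral_sq_mul_cexp_mul_eq_fourier χ hχ ha]
  have hint : Integrable fun p : ℝ ↦ φ p * conj (ψ p) := by
    obtain ⟨C, -, hC⟩ := ψ.decay 0 0
    refine φ.integrable.mul_bdd (c := C) ?_ (.of_forall fun p ↦ by simpa using hC p)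
    exact (Complex.continuous_conj.comp ψ.continuous).aestronglyMeasurable
  calc _ = ∫ a in Set.Ioi (0 : ℝ), ((c ^ 2 * (8 * π) : ℝ) : ℂ) * ∫ p in Set.Ioi (0 : ℝ),
        ((a ^ ((1 : ℝ) / 2) * Real.exp (-(a * p ^ 2)) : ℝ) : ℂ) *
          ((p ^ 3 : ℝ) * (φ p * conj (ψ p))) := by
        refine setIntegral_congr_fun measurableSet_Ioi fun a ha ↦ ?_
        have ha : 0 < a := ha
        simp only [hAe' φ hφ ha, hAe' ψ hψ ha, map_mul, Complex.conj_ofReal]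
        rw [integral_mul_const]
        simp_rw [mul_mul_mul_comm (c : ℂ)]
        rw [integral_const_mul, Measure.integral_comp_mul_left (fun w ↦
            𝓕 (halfLineDensity φ a) w * conj (𝓕 (halfLineDensity ψ a) w)),
          integral_fourier_mul_conj_fourier_s8 (integrable_halfLineDensity φ ha)
            (memLp_two_halfLineDensity φ ha) (integrable_halfLineDensity ψ ha)
            (memLp_two_halfLineDensity ψ ha), integral_halfLineDensity_mul_conj]
        simp_rw [Complex.ofReal_mul (a ^ ((1 : ℝ) / 2)), mul_assoc]
        rw [integral_const_mul, abs_inv, abs_neg, abs_inv, inv_inv,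
          abs_of_pos (by have := Real.pi_pos; positivity), Complex.real_smul]
        push_cast
        ring
    _ = ((c ^ 2 * (2 * π * √π) : ℝ) : ℂ) * (2 * ∫ p in Set.Ioi (0 : ℝ), φ p * conj (ψ p)) := by
        rw [integral_const_mul, integral_integral_rpow_half_mul_exp hint]
        push_cast
        ring
    _ = ∫ p : ℝ, φ p * conj (ψ p) := by
        rw [hcsq, Complex.ofReal_one, one_mul,
          integral_eq_two_mul_integral_Ioi_of_even hint (by simp [hφ, hψ])]
end

section
/- Let ψ be an odd Schwartz function on ℝ and let F(z) = (1/(2π^{3/4})) ∫_ℝ p · e^{i z p²/2} · ψ(p) dp for Im z > 0. Then for every z in the open upper half-plane, ∫_{Im w > 0} (1/(8π)) · ((z − conj(w))/(2i))^{−3/2} · F(w) · (Im w)^{−1/2} dA(w) = F(z); i.e., ρ_{−1/2}^z(w) = (1/(8π))((z − w̄)/(2i))^{−3/2} is a reproducing kernel for the space H_{−1/2} on the image of A_o. -/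
open MeasureTheory Complex Real

lemma integrable_sq_mul_cexp_neg_mul_sq {b : ℂ} (hb : 0 < b.re) :
    Integrable fun x : ℝ => (x : ℂ) ^ 2 * cexp (-b * (x : ℂ) ^ 2) := by
  have h := integrable_rpow_mul_exp_neg_mul_sq hb (s := 2) (by norm_num)
  refine h.mono' (by fun_prop) (Filter.Eventually.of_forall fun x => ?_)
  rw [norm_mul, norm_cexp_neg_mul_sq]
  simp

lemma integral_sq_mul_cexp_neg_mul_sq {b : ℂ} (hb : 0 < b.re) :
    ∫ x : ℝ, (x : ℂ) ^ 2 * cexp (-b * (x : ℂ) ^ 2) = (π / b) ^ (1 / 2 : ℂ) / (2 * b) := by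
  have hb0 : b ≠ 0 := fun h => by simp [h] at hb
  have h1 := integrable_cexp_neg_mul_sq hb
  have h2 := (integrable_sq_mul_cexp_neg_mul_sq hb).const_mul (2 * b)
  have hd (x : ℝ) : HasDerivAt (fun x : ℝ => (x : ℂ) * cexp (-b * (x : ℂ) ^ 2))
      (cexp (-b * (x : ℂ) ^ 2) - 2 * b * ((x : ℂ) ^ 2 * cexp (-b * (x : ℂ) ^ 2))) x := by
    have hx : HasDerivAt (fun x : ℝ => (x : ℂ)) 1 x := Complex.ofRealCLM.hasDerivAt
    convert! hx.mul (((hx.pow 2).const_mul (-b)).cexp) using 1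
    simp
    ring
  have h0 := integral_eq_zero_of_hasDerivAt_of_integrable hd (h1.sub h2)
    (integrable_mul_cexp_neg_mul_sq hb)
  rw [integral_sub h1 h2, integral_const_mul, integral_gaussian_complex hb, sub_eq_zero] at h0
  rw [h0, mul_div_cancel_left₀ _ (mul_ne_zero two_ne_zero hb0)]

lemma pi_div_cpow_half_div {b : ℂ} (hb : 0 < b.re) :
    ((π : ℂ) / b) ^ (1 / 2 : ℂ) / (2 * b) = (√π / 2 : ℝ) * b ^ (-(3 : ℂ) / 2) := by
  have hb0 : b ≠ 0 := fun h => by simp [h] at hb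
  have harg : b.arg ≠ π := by
    intro h
    have := (arg_eq_pi_iff.1 h).1
    linarith
  have hs : ((√π : ℝ) : ℂ) = (π : ℂ) ^ (1 / 2 : ℂ) := by
    rw [Real.sqrt_eq_rpow, ofReal_cpow pi_pos.le]
    norm_num
  have h3 : b ^ (-(3 : ℂ) / 2) = (b ^ (1 / 2 : ℂ))⁻¹ * b⁻¹ := by
    rw [← cpow_neg, ← cpow_neg_one, ← cpow_add _ _ hb0]
    norm_num
  have h4 : ((π : ℂ) / b) ^ (1 / 2 : ℂ) = (π : ℂ) ^ (1 / 2 : ℂ) * (b ^ (1 / 2 : ℂ))⁻¹ := by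
    rw [div_eq_mul_inv, ← inv_cpow _ _ harg]
    have hpi : (π : ℂ) ≠ 0 := ofReal_ne_zero.2 pi_ne_zero
    rw [cpow_def_of_ne_zero (mul_ne_zero hpi (inv_ne_zero hb0)), cpow_def_of_ne_zero hpi,
      cpow_def_of_ne_zero (inv_ne_zero hb0), ← Complex.exp_add,
      log_ofReal_mul pi_pos (inv_ne_zero hb0), add_mul, ← ofReal_log pi_pos.le]
  rw [h4, h3]
  push_cast
  rw [hs]
  field_simp

lemma norm_sqrt_mul_cexp (b : ℂ) (r : ℝ) :
    ‖((√r : ℝ) : ℂ) * cexp (-b * r)‖ = √r * rexp (-b.re * r) := by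
  rw [norm_mul, Complex.norm_exp, norm_real, norm_of_nonneg (Real.sqrt_nonneg r)]
  simp

lemma sqrt_mul_cexp_eqOn_zero (b : ℂ) :
    Set.EqOn (fun r : ℝ => ((√r : ℝ) : ℂ) * cexp (-b * r)) 0 (Set.Iic 0) := fun r hr => by
  simp [Real.sqrt_eq_zero_of_nonpos hr]

lemma integrable_sqrt_mul_cexp {b : ℂ} (hb : 0 < b.re) :
    Integrable fun r : ℝ => ((√r : ℝ) : ℂ) * cexp (-b * r) := by
  rw [← integrableOn_univ, ← Set.Iic_union_Ioi (a := (0 : ℝ))]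
  refine IntegrableOn.union ?_ ?_
  · exact (integrableOn_congr_fun (sqrt_mul_cexp_eqOn_zero b) measurableSet_Iic).2 integrableOn_zero
  · have h := integrableOn_rpow_mul_exp_neg_mul_rpow (s := 1 / 2) (p := 1) (by norm_num) one_pos hb
    refine Integrable.mono' h (by fun_prop) (Filter.Eventually.of_forall fun r => ?_)
    rw [norm_sqrt_mul_cexp, Real.rpow_one, Real.sqrt_eq_rpow]

lemma integral_sqrt_mul_cexp {b : ℂ} (hb : 0 < b.re) :
    ∫ r : ℝ, ((√r : ℝ) : ℂ) * cexp (-b * r) = (√π / 2 : ℝ) * b ^ (-(3 : ℂ) / 2) := by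
  rw [← pi_div_cpow_half_div hb, ← integral_sq_mul_cexp_neg_mul_sq hb,
    ← setIntegral_eq_integral_of_forall_compl_eq_zero (s := Set.Ioi (0 : ℝ))
      (fun r hr => sqrt_mul_cexp_eqOn_zero b (Set.mem_Iic.2 (not_lt.1 hr))),
    ← integral_comp_rpow_Ioi_of_pos (p := 2) two_pos]
  have heven : ∀ x : ℝ, (x : ℂ) ^ 2 * cexp (-b * (x : ℂ) ^ 2)
      = ((-x : ℝ) : ℂ) ^ 2 * cexp (-b * ((-x : ℝ) : ℂ) ^ 2) := fun x => by simp
  have hint := integrable_sq_mul_cexp_neg_mul_sq hb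
  have hneg := integral_comp_neg_Iic (0 : ℝ)
    (fun x : ℝ => (x : ℂ) ^ 2 * cexp (-b * (x : ℂ) ^ 2))
  simp only [← heven, neg_zero] at hneg
  rw [← intervalIntegral.integral_Iic_add_Ioi hint.integrableOn hint.integrableOn (b := (0 : ℝ)),
    hneg, ← two_mul, ← integral_const_mul]
  refine setIntegral_congr_fun measurableSet_Ioi fun x hx => ?_
  have hx0 : 0 < x := hx
  norm_num [Real.sqrt_sq hx0.le, real_smul]
  ring

open FourierTransform in
lemma fourier_sqrt_mul_cexp {b : ℂ} (hb : 0 < b.re) (w : ℝ) :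
    𝓕 (fun r : ℝ => ((√r : ℝ) : ℂ) * cexp (-b * r)) w =
      (√π / 2 : ℝ) * (b + I * (2 * π * w : ℝ)) ^ (-(3 : ℂ) / 2) := by
  rw [Real.fourier_real_eq_integral_exp_smul, ← integral_sqrt_mul_cexp (by simpa using hb)]
  congr 1 with r
  rw [smul_eq_mul, mul_left_comm, ← Complex.exp_add]
  congr 2
  push_cast
  ring

lemma norm_cpow_neg_three_half_le {b : ℂ} {c : ℝ} (hc : 0 < c) (hb : c ≤ b.re) (u : ℝ) :
    ‖(b + I * u) ^ (-(3 : ℂ) / 2)‖ ≤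
      c ^ (-(3 : ℝ) / 2) * (1 + ‖c⁻¹ * (u + b.im)‖ ^ 2) ^ (-(3 / 2 : ℝ) / 2) := by
  have h1 : (-(3 : ℂ) / 2) = ((-(3 : ℝ) / 2 : ℝ) : ℂ) := by push_cast; rfl
  have h2 : c * √(1 + ‖c⁻¹ * (u + b.im)‖ ^ 2) ≤ ‖b + I * u‖ := by
    rw [← abs_of_nonneg (norm_nonneg (b + I * u)), ← Real.sqrt_sq_eq_abs, Complex.sq_norm,
      ← Real.sqrt_sq hc.le, ← Real.sqrt_mul (by positivity)]
    apply Real.sqrt_le_sqrt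
    rw [Real.sqrt_sq hc.le, normSq_apply, Real.norm_eq_abs, sq_abs]
    have : c ^ 2 * (1 + (c⁻¹ * (u + b.im)) ^ 2) = c ^ 2 + (u + b.im) ^ 2 := by field_simp
    rw [this]
    simp
    nlinarith
  rw [h1, norm_cpow_real]
  refine (Real.rpow_le_rpow_of_nonpos (by positivity) h2 (by norm_num)).trans_eq ?_
  rw [Real.mul_rpow hc.le (Real.sqrt_nonneg _), Real.sqrt_eq_rpow, ← Real.rpow_mul (by positivity)]
  norm_num

lemma integrable_rpow_bound {c : ℝ} (hc : 0 < c) (d : ℝ) :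
    Integrable fun u : ℝ =>
      c ^ (-(3 : ℝ) / 2) * (1 + ‖c⁻¹ * (u + d)‖ ^ 2) ^ (-(3 / 2 : ℝ) / 2) := by
  have h := integrable_rpow_neg_one_add_norm_sq (E := ℝ) (μ := volume) (r := 3 / 2) (by norm_num)
  exact ((h.comp_mul_left' (inv_ne_zero hc.ne')).comp_add_right d).const_mul _

lemma integral_cpow_mul_cexp {b : ℂ} (hb : 0 < b.re) (q : ℝ) :
    ∫ u : ℝ, (b + I * u) ^ (-(3 : ℂ) / 2) * cexp (I * u * q) =
      4 * √π * √q * cexp (-b * q) := by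
  have hi : Integrable fun u : ℝ => (b + I * u) ^ (-(3 : ℂ) / 2) := by
    refine (integrable_rpow_bound hb b.im).mono' ?_
      (Filter.Eventually.of_forall fun u => norm_cpow_neg_three_half_le hb le_rfl u)
    exact (Measurable.pow_const (by fun_prop) _).aestronglyMeasurable
  have hf := integrable_sqrt_mul_cexp hb
  have hinv := hf.fourierInv_fourier_eq (v := q) (by
    simp_rw [funext (fourier_sqrt_mul_cexp hb)]
    exact (hi.comp_mul_left' (R := 2 * π) (by positivity)).const_mul _) (by fun_prop)
  rw [Real.fourierInv_eq'] at hinv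
  simp_rw [fourier_sqrt_mul_cexp hb] at hinv
  have h2 := Measure.integral_comp_mul_left
    (fun u : ℝ => (b + I * u) ^ (-(3 : ℂ) / 2) * cexp (I * u * q)) (2 * π)
  have h3 : (√π / 2 : ℝ) * ∫ w : ℝ, (b + I * (2 * π * w : ℝ)) ^ (-(3 : ℂ) / 2) *
      cexp (I * (2 * π * w : ℝ) * q) = √q * cexp (-b * q) := by
    rw [← hinv, ← integral_const_mul]
    congr 1 with w
    rw [smul_eq_mul]
    have : ((2 * π * inner ℝ w q : ℝ) : ℂ) * I = I * (2 * π * w : ℝ) * q := by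
      simp; ring
    rw [this]
    ring
  rw [h2, abs_of_pos (by positivity), real_smul] at h3
  have hp : (π : ℂ) = √π * √π := by rw [← ofReal_mul, Real.mul_self_sqrt pi_pos.le]
  have hp0 : ((√π : ℝ) : ℂ) ≠ 0 := ofReal_ne_zero.2 (by positivity)
  rw [mul_assoc, ← h3]
  generalize ∫ u : ℝ, (b + I * u) ^ (-(3 : ℂ) / 2) * cexp (I * u * q) = J
  push_cast
  rw [hp]
  field_simp
  norm_num

/-- The integrand of the iterated integral, in the coordinates `w = v.1 + v.2 * I`. -/
noncomputable def kernelIntegrand (ψ : SchwartzMap ℝ ℂ) (z : ℂ) (v : ℝ × ℝ) (p : ℝ) : ℂ :=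
  ((v.2 - I * z) / 2 + I * (v.1 / 2 : ℝ)) ^ (-(3 : ℂ) / 2) *
    ((p : ℂ) * cexp (I * (v.1 + v.2 * I) * (p : ℂ) ^ 2 / 2) * ψ p) *
    ((v.2 ^ (-(1 : ℝ) / 2) : ℝ) : ℂ)

lemma integral_rpow_mul_exp {p : ℝ} (hp : p ≠ 0) {c : ℝ} (hc : 0 < c) :
    ∫ y in Set.Ioi (0 : ℝ), y ^ (-(1 : ℝ) / 2) * rexp (-(c * p ^ 2 * y)) =
      √π / (√c * |p|) := by
  have h := Real.integral_rpow_mul_exp_neg_mul_Ioi (a := 1 / 2) (r := c * p ^ 2) (by norm_num)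
    (by positivity)
  norm_num at h ⊢
  rw [h, ← Real.sqrt_eq_rpow, Real.Gamma_one_half_eq, Real.sqrt_mul (by positivity), Real.sqrt_inv,
    Real.sqrt_inv, Real.sqrt_sq_eq_abs]
  field_simp

lemma integrable_rpow_mul_exp {p : ℝ} (hp : p ≠ 0) {c : ℝ} (hc : 0 < c) :
    IntegrableOn (fun y : ℝ => y ^ (-(1 : ℝ) / 2) * rexp (-(c * p ^ 2 * y))) (Set.Ioi 0) := by
  have h := integrableOn_rpow_mul_exp_neg_mul_rpow (s := -(1 : ℝ) / 2) (p := 1) (b := c * p ^ 2)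
    (by norm_num) one_pos (by positivity)
  simpa only [Real.rpow_one, neg_mul] using h

lemma integrable_kernel_bound (ψ : SchwartzMap ℝ ℂ) {h : ℝ → ℝ} (hh : Integrable h) :
    Integrable (fun a : (ℝ × ℝ) × ℝ => h a.1.1 *
      (a.1.2 ^ (-(1 : ℝ) / 2) * rexp (-(1 / 2 * a.2 ^ 2 * a.1.2))) * (|a.2| * ‖ψ a.2‖))
      (((volume : Measure ℝ).prod (volume.restrict (Set.Ioi (0 : ℝ)))).prod volume) := by
  have h0 : ∀ᵐ p : ℝ, p ≠ 0 := Measure.ae_ne volume 0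
  rw [integrable_prod_iff']
  · constructor
    · filter_upwards [h0] with p hp
      exact (hh.mul_prod (integrable_rpow_mul_exp hp (by norm_num : (0 : ℝ) < 1 / 2))).mul_const _
    · refine ((ψ.integrable.norm).const_mul ((∫ x, ‖h x‖) * (√π / √(1 / 2)))).congr ?_
      filter_upwards [h0] with p hp
      have habs : ∫ y in Set.Ioi (0 : ℝ), ‖y ^ (-(1 : ℝ) / 2) * rexp (-(1 / 2 * p ^ 2 * y))‖ =
          √π / (√(1 / 2) * |p|) := by
        rw [← integral_rpow_mul_exp hp (by norm_num : (0 : ℝ) < 1 / 2)]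
        refine setIntegral_congr_fun measurableSet_Ioi fun y hy => ?_
        have hy0 : 0 < y := hy
        exact Real.norm_of_nonneg (by positivity)
      simp_rw [norm_mul _ (|p| * ‖ψ p‖), norm_mul (h _)]
      rw [integral_mul_const, integral_prod_mul (fun x => ‖h x‖)
        (fun y : ℝ => ‖y ^ (-(1 : ℝ) / 2) * rexp (-(1 / 2 * p ^ 2 * y))‖), habs,
        Real.norm_of_nonneg (by positivity)]
      have := abs_pos.2 hp
      field_simp
  · have h1 : AEStronglyMeasurable (fun a : (ℝ × ℝ) × ℝ => h a.1.1)
        (((volume : Measure ℝ).prod (volume.restrict (Set.Ioi (0 : ℝ)))).prod volume) :=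
      hh.aestronglyMeasurable.comp_fst.comp_fst
    refine (h1.mul (Measurable.aestronglyMeasurable ?_)).mul (Measurable.aestronglyMeasurable ?_)
    · fun_prop
    · have := ψ.continuous.measurable
      fun_prop

lemma ae_pos_snd_fst : ∀ᵐ a : (ℝ × ℝ) × ℝ
    ∂(((volume : Measure ℝ).prod (volume.restrict (Set.Ioi (0 : ℝ)))).prod volume),
      0 < a.1.2 := by
  have h : ∀ᵐ y ∂(volume.restrict (Set.Ioi (0 : ℝ))), 0 < y := ae_restrict_mem measurableSet_Ioi
  exact Measure.quasiMeasurePreserving_fst.ae (Measure.quasiMeasurePreserving_snd.ae h)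

lemma integrable_kernelIntegrand (ψ : SchwartzMap ℝ ℂ) {z : ℂ} (hz : 0 < z.im) :
    Integrable (Function.uncurry (kernelIntegrand ψ z))
      (((volume : Measure ℝ).prod (volume.restrict (Set.Ioi (0 : ℝ)))).prod volume) := by
  have hc : 0 < z.im / 2 := by positivity
  have hh := (integrable_rpow_bound hc (-z.re / 2)).comp_mul_left' (R := 1 / 2) (by norm_num)
  refine (integrable_kernel_bound ψ hh).mono' ?_ ?_
  · have := ψ.continuous.measurable
    unfold kernelIntegrand Function.uncurry
    refine Measurable.aestronglyMeasurable ?_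
    refine (Measurable.mul (Measurable.pow_const (by fun_prop) _) (by fun_prop)).mul (by fun_prop)
  · filter_upwards [ae_pos_snd_fst] with a ha
    obtain ⟨⟨x, y⟩, p⟩ := a
    simp only [Function.uncurry, kernelIntegrand, norm_mul, Complex.norm_exp] at ha ⊢
    have hb : z.im / 2 ≤ (((y : ℂ) - I * z) / 2).re := by simp; linarith
    have him : (((y : ℂ) - I * z) / 2).im = -z.re / 2 := by simp
    have hk := norm_cpow_neg_three_half_le hc hb (x / 2)
    rw [him, norm_mul] at hk
    have he : (I * (x + y * I) * (p : ℂ) ^ 2 / 2).re = -(1 / 2 * p ^ 2 * y) := by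
      have : I * (x + y * I) * (p : ℂ) ^ 2 / 2 = (-(1 / 2 * p ^ 2 * y) : ℝ) +
          ((x * p ^ 2 / 2 : ℝ) : ℂ) * I := by
        push_cast
        linear_combination (y * (p : ℂ) ^ 2 / 2) * I_sq
      rw [this, add_re, ofReal_re, re_ofReal_mul, I_re, mul_zero, add_zero]
    rw [he, norm_real, norm_real, Real.norm_eq_abs p, Real.norm_of_nonneg (by positivity)]
    have hx : 1 / 2 * x = x / 2 := by ring
    simp only [hx]
    calc _ = _ * ((y ^ (-(1 : ℝ) / 2) * rexp (-(1 / 2 * p ^ 2 * y))) * (|p| * ‖ψ p‖)) := by ring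
      _ ≤ _ := by
        rw [mul_assoc (_ * _)]
        gcongr

lemma integral_kernelIntegrand_fst (ψ : SchwartzMap ℝ ℂ) {z : ℂ} (hz : 0 < z.im) (p : ℝ)
    {y : ℝ} (hy : 0 < y) :
    ∫ x : ℝ, kernelIntegrand ψ z (x, y) p =
      8 * √π * (|p| : ℝ) * ((p : ℂ) * cexp (I * z * (p : ℂ) ^ 2 / 2) * ψ p) *
        ((y ^ (-(1 : ℝ) / 2) * rexp (-(1 * p ^ 2 * y)) : ℝ) : ℂ) := by
  have hb : 0 < (((y : ℂ) - I * z) / 2).re := by simp; linarith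
  have hF := integral_cpow_mul_cexp hb (p ^ 2)
  have hsub := Measure.integral_comp_mul_left (fun u : ℝ =>
    (((y : ℂ) - I * z) / 2 + I * u) ^ (-(3 : ℂ) / 2) * cexp (I * u * (p ^ 2 : ℝ))) (1 / 2)
  rw [hF, Real.sqrt_sq_eq_abs] at hsub
  have heq (x : ℝ) : kernelIntegrand ψ z (x, y) p =
      ((((y : ℂ) - I * z) / 2 + I * (1 / 2 * x : ℝ)) ^ (-(3 : ℂ) / 2) *
        cexp (I * (1 / 2 * x : ℝ) * (p ^ 2 : ℝ))) *
      ((p : ℂ) * cexp (-y * (p : ℂ) ^ 2 / 2) * ψ p * (y ^ (-(1 : ℝ) / 2) : ℝ)) := by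
    have hx : x / 2 = 1 / 2 * x := by ring
    have he : I * (x + y * I) * (p : ℂ) ^ 2 / 2 =
        I * (1 / 2 * x : ℝ) * (p ^ 2 : ℝ) + -y * (p : ℂ) ^ 2 / 2 := by
      push_cast
      linear_combination (y * (p : ℂ) ^ 2 / 2) * I_sq
    simp only [kernelIntegrand]
    rw [hx, he, Complex.exp_add]
    ring
  simp_rw [heq]
  rw [integral_mul_const, hsub, real_smul]
  have he : cexp (-(((y : ℂ) - I * z) / 2) * (p ^ 2 : ℝ)) * cexp (-y * (p : ℂ) ^ 2 / 2) =
      cexp (I * z * (p : ℂ) ^ 2 / 2) * (rexp (-(1 * p ^ 2 * y)) : ℝ) := by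
    rw [ofReal_exp, ← Complex.exp_add, ← Complex.exp_add]
    congr 1
    push_cast
    ring
  norm_num at he ⊢
  linear_combination (8 * √π * (|p| : ℝ) * p * ψ p * ((y ^ (-(1 / 2 : ℝ)) : ℝ) : ℂ)) * he

lemma integral_kernelIntegrand (ψ : SchwartzMap ℝ ℂ) {z : ℂ} (hz : 0 < z.im) {p : ℝ}
    (hp : p ≠ 0)
    (hi : Integrable (fun v => kernelIntegrand ψ z v p)
      ((volume : Measure ℝ).prod (volume.restrict (Set.Ioi (0 : ℝ))))) :
    ∫ v, kernelIntegrand ψ z v p ∂((volume : Measure ℝ).prod (volume.restrict (Set.Ioi (0 : ℝ)))) =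
      8 * π * ((p : ℂ) * cexp (I * z * (p : ℂ) ^ 2 / 2) * ψ p) := by
  rw [integral_prod_symm _ hi,
    setIntegral_congr_fun measurableSet_Ioi fun y hy => integral_kernelIntegrand_fst ψ hz p hy,
    integral_const_mul, integral_complex_ofReal, integral_rpow_mul_exp hp one_pos]
  have hp0 : ((|p| : ℝ) : ℂ) ≠ 0 := ofReal_ne_zero.2 (abs_ne_zero.2 hp)
  have hpi : (π : ℂ) = √π * √π := by rw [← ofReal_mul, Real.mul_self_sqrt pi_pos.le]
  rw [hpi]
  push_cast
  simp only [Real.sqrt_one, ofReal_one, one_mul]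
  field_simp

/-- `ρ(w) = (1 / (8π)) ((z - conj w) / (2i)) ^ (-3/2)` reproduces the values at `z` of the transform
of a Schwartz function, with respect to the measure `(Im w) ^ (-1/2) dA(w)`. -/
theorem reproducing_kernel_neg_half (ψ : SchwartzMap ℝ ℂ)
    (hψ : ∀ p : ℝ, ψ (-p) = -ψ p)
    (F : ℂ → ℂ)
    (hF : ∀ z : ℂ, 0 < z.im →
      F z = (1 / (2 * (Real.pi : ℂ) ^ ((3 : ℂ) / 4))) *
        ∫ p : ℝ, (p : ℂ) * Complex.exp (Complex.I * z * (p : ℂ) ^ 2 / 2) * ψ p)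
    (z : ℂ) (hz : 0 < z.im) :
    ∫ w in {w : ℂ | 0 < w.im},
        (1 / (8 * (Real.pi : ℂ))) *
          ((z - (starRingEnd ℂ) w) / (2 * Complex.I)) ^ (-(3 : ℂ) / 2) *
          F w * ((w.im ^ (-(1 : ℝ) / 2) : ℝ) : ℂ)
      = F z := by
  set C : ℂ := 1 / (2 * (Real.pi : ℂ) ^ ((3 : ℂ) / 4))
  have hset : {w : ℂ | 0 < w.im} = measurableEquivRealProd ⁻¹' (Set.univ ×ˢ Set.Ioi (0 : ℝ)) := by
    ext w
    simp
  have hm : MeasurableSet {w : ℂ | 0 < w.im} := measurableSet_lt measurable_const measurable_im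
  have hcongr : Set.EqOn (fun w : ℂ => (1 / (8 * (Real.pi : ℂ))) *
          ((z - (starRingEnd ℂ) w) / (2 * Complex.I)) ^ (-(3 : ℂ) / 2) *
          F w * ((w.im ^ (-(1 : ℝ) / 2) : ℝ) : ℂ))
      (fun w => (fun v => (1 / (8 * (Real.pi : ℂ))) * C * ∫ p, kernelIntegrand ψ z v p)
        (measurableEquivRealProd w)) {w : ℂ | 0 < w.im} := by
    intro w hw
    have harg : (z - (starRingEnd ℂ) w) / (2 * I) =
        (w.im - I * z) / 2 + I * (w.re / 2 : ℝ) := by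
      rw [div_eq_iff (by simp)]
      apply Complex.ext <;> simp <;> ring
    simp only [kernelIntegrand, measurableEquivRealProd_apply]
    rw [integral_mul_const, integral_const_mul, hF w hw, harg, re_add_im]
    ring
  rw [setIntegral_congr_fun hm hcongr, hset,
    volume_preserving_equiv_real_prod.setIntegral_preimage_emb
      measurableEquivRealProd.measurableEmbedding
      (fun v => (1 / (8 * (Real.pi : ℂ))) * C * ∫ p, kernelIntegrand ψ z v p),
    integral_const_mul, Measure.volume_eq_prod,
    ← Measure.prod_restrict, Measure.restrict_univ,
    integral_integral_swap (integrable_kernelIntegrand ψ hz)]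
  have hae : ∀ᵐ p : ℝ, ∫ v, kernelIntegrand ψ z v p
      ∂((volume : Measure ℝ).prod (volume.restrict (Set.Ioi (0 : ℝ)))) =
        8 * π * ((p : ℂ) * cexp (I * z * (p : ℂ) ^ 2 / 2) * ψ p) := by
    filter_upwards [Measure.ae_ne volume 0, (integrable_kernelIntegrand ψ hz).prod_left_ae]
      with p hp hi
    exact integral_kernelIntegrand ψ hz hp hi
  rw [integral_congr_ae hae, integral_const_mul, hF z hz]
  have hpi : (π : ℂ) ≠ 0 := ofReal_ne_zero.2 pi_ne_zero
  generalize ∫ p : ℝ, (p : ℂ) * cexp (I * z * (p : ℂ) ^ 2 / 2) * ψ p = J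
  field_simp
end

section
/- Let ψ be an even Schwartz function on ℝ and let F(z) = (1/(√2 · π^{3/4})) ∫_ℝ p² · e^{i z p²/2} · ψ(p) dp for Im z > 0. Then for every z in the open upper half-plane, ∫_{Im w > 0} (3/(8π)) · ((z − conj(w))/(2i))^{−5/2} · F(w) · (Im w)^{1/2} dA(w) = F(z); i.e., ρ_{1/2}^z(w) = (3/(8π))((z − w̄)/(2i))^{−5/2} is a reproducing kernel for the space H_{1/2} on the image of A_e. -/
open MeasureTheory Complex Real

/-- Integrability of the Laplace integrand `t ^ (a - 1) * exp (-ζ t)` for complex `ζ`. -/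
lemma integrableOn_cpow_mul_cexp_neg_mul {a ζ : ℂ} (ha : 0 < a.re) (hζ : 0 < ζ.re) :
    IntegrableOn (fun t : ℝ ↦ (t : ℂ) ^ (a - 1) * cexp (-(ζ * t))) (Set.Ioi 0) := by
  have h := integrableOn_rpow_mul_exp_neg_mul_rpow (s := a.re - 1) (p := 1) (b := ζ.re)
    (by linarith) one_pos hζ
  refine Integrable.mono' h (by fun_prop) ?_
  filter_upwards [ae_restrict_mem measurableSet_Ioi] with t ht
  rw [norm_mul, norm_cpow_eq_rpow_re_of_pos ht, norm_exp]
  simp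

/-- The Laplace transform of `t ^ (a - 1)` is holomorphic on the right half-plane. -/
lemma differentiableOn_integral_cpow_mul_cexp_neg_mul {a : ℂ} (ha : 0 < a.re) :
    DifferentiableOn ℂ
      (fun ζ : ℂ ↦ ∫ t : ℝ in Set.Ioi 0, (t : ℂ) ^ (a - 1) * cexp (-(ζ * t)))
      {ζ | 0 < ζ.re} := by
  intro ζ (hζ : 0 < ζ.re)
  have hs : {η : ℂ | ζ.re / 2 < η.re} ∈ nhds ζ :=
    (isOpen_lt continuous_const continuous_re).mem_nhds (by simp only [Set.mem_ofPred_eq]; linarith)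
  refine (hasDerivAt_integral_of_dominated_loc_of_deriv_le
    (μ := volume.restrict (Set.Ioi 0))
    (F := fun η (t : ℝ) ↦ (t : ℂ) ^ (a - 1) * cexp (-(η * t)))
    (F' := fun η (t : ℝ) ↦ (t : ℂ) ^ (a - 1) * (cexp (-(η * t)) * (-t)))
    (bound := fun t : ℝ ↦ t ^ a.re * rexp (-(ζ.re / 2) * t ^ (1 : ℝ)))
    hs (Filter.Eventually.of_forall fun η ↦ by fun_prop)
    (integrableOn_cpow_mul_cexp_neg_mul ha hζ) (by fun_prop) ?_
    (integrableOn_rpow_mul_exp_neg_mul_rpow (by linarith) one_pos (by linarith))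
    ?_).2.differentiableAt.differentiableWithinAt
  · filter_upwards [ae_restrict_mem measurableSet_Ioi] with t ht η hη
    have ht : 0 < t := ht
    have hη : ζ.re / 2 < η.re := hη
    rw [norm_mul, norm_cpow_eq_rpow_re_of_pos ht, norm_mul, norm_exp, norm_neg, norm_real,
      Real.norm_of_nonneg ht.le, Real.rpow_one]
    calc _ = t ^ a.re * rexp (-(η.re * t)) := by
          rw [sub_re, one_re, Real.rpow_sub_one ht.ne']
          simp
          field_simp
      _ ≤ _ := by
          gcongr
          nlinarith
  · refine Filter.Eventually.of_forall fun t η _ ↦ ?_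
    have := (((hasDerivAt_id η).mul_const (t : ℂ)).neg.cexp).const_mul ((t : ℂ) ^ (a - 1))
    simpa using this

/-- Euler's integral for `Γ`, rescaled by a complex number of positive real part. -/
lemma integral_cpow_mul_cexp_neg_mul {a ζ : ℂ} (ha : 0 < a.re) (hζ : 0 < ζ.re) :
    ∫ t : ℝ in Set.Ioi 0, (t : ℂ) ^ (a - 1) * cexp (-(ζ * t)) = ζ ^ (-a) * Complex.Gamma a := by
  have hU : IsOpen {ζ : ℂ | 0 < ζ.re} := isOpen_lt continuous_const continuous_re
  refine AnalyticOnNhd.eqOn_of_preconnected_of_frequently_eq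
    (f := fun ζ : ℂ ↦ ∫ t : ℝ in Set.Ioi 0, (t : ℂ) ^ (a - 1) * cexp (-(ζ * t)))
    (g := fun ζ : ℂ ↦ ζ ^ (-a) * Complex.Gamma a) (U := {ζ : ℂ | 0 < ζ.re}) (z₀ := 1)
    ((differentiableOn_integral_cpow_mul_cexp_neg_mul ha).analyticOnNhd hU)
    (DifferentiableOn.analyticOnNhd (fun η hη ↦ ?_) hU)
    (convex_halfSpace_re_gt 0).isPreconnected (by simp) ?_ hζ
  · exact ((differentiableAt_id.cpow_const (Or.inl hη)).mul_const _).differentiableWithinAt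
  · have ht : Filter.Tendsto (fun x : ℝ ↦ (x : ℂ)) (nhdsWithin 1 {1}ᶜ) (nhdsWithin 1 {1}ᶜ) := by
      refine tendsto_nhdsWithin_of_tendsto_nhds_of_eventually_within _ ?_ ?_
      · exact (continuous_ofReal.tendsto' 1 1 ofReal_one).mono_left nhdsWithin_le_nhds
      · filter_upwards [self_mem_nhdsWithin] with x hx
        simpa using hx
    refine ht.frequently (Filter.Eventually.frequently ?_)
    filter_upwards [nhdsWithin_le_nhds (lt_mem_nhds (zero_lt_one (α := ℝ)))] with x hx
    rw [Complex.integral_cpow_mul_exp_neg_mul_Ioi ha hx, one_div, cpow_neg, inv_cpow]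
    rw [arg_ofReal_of_nonneg hx.le]
    exact pi_pos.ne

/-- The kernel `x ↦ (c + i x) ^ (-a)` is integrable for `c > 0` and `a > 1`. -/
lemma integrable_add_mul_I_cpow_neg {a c : ℝ} (ha : 1 < a) (hc : 0 < c) :
    Integrable (fun x : ℝ ↦ ((c : ℂ) + x * I) ^ (-(a : ℂ))) := by
  have h := integrable_rpow_neg_one_add_norm_sq (E := ℝ) (μ := volume) (r := a) (by simpa)
  refine (h.const_mul ((min c 1 ^ 2) ^ (-a / 2))).mono' ?_ (Filter.Eventually.of_forall fun x ↦ ?_)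
  · exact (by fun_prop : Measurable _).aestronglyMeasurable
  · rw [← ofReal_neg, norm_cpow_real, norm_add_mul_I, Real.sqrt_eq_rpow,
      ← Real.rpow_mul (by positivity), ← Real.mul_rpow (by positivity) (by positivity)]
    have hm : 0 < min c 1 := lt_min hc one_pos
    rw [show 1 / 2 * -a = -a / 2 by ring]
    refine Real.rpow_le_rpow_of_nonpos (by positivity) ?_ (by linarith)
    have h1 : min c 1 ^ 2 ≤ c ^ 2 := by gcongr; exact min_le_left _ _
    have h2 : min c 1 ^ 2 ≤ 1 := pow_le_one₀ hm.le (min_le_right _ _)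
    rw [Real.norm_eq_abs, sq_abs]
    nlinarith [sq_nonneg x]

open FourierTransform in
/-- Fourier inversion for `t ^ (a - 1) * exp (-c t)` on the positive half-line. -/
lemma integral_add_mul_I_cpow_neg_mul_cexp {a c t : ℝ} (ha : 1 < a) (hc : 0 < c) (ht : 0 < t) :
    (∫ x : ℝ, ((c : ℂ) + x * I) ^ (-(a : ℂ)) * cexp (t * x * I)) * Complex.Gamma a =
      2 * π * ((t : ℂ) ^ ((a : ℂ) - 1) * cexp (-(c * t))) := by
  set f : ℝ → ℂ := (Set.Ioi 0).indicator fun r : ℝ ↦ (r : ℂ) ^ ((a : ℂ) - 1) * cexp (-(c * r))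
    with hf
  have hf_int : Integrable f :=
    (integrable_indicator_iff measurableSet_Ioi).2
      (integrableOn_cpow_mul_cexp_neg_mul (by simp; linarith) (by simpa))
  have hF : 𝓕 f = fun ξ : ℝ ↦
      ((c : ℂ) + (2 * π * ξ : ℝ) * I) ^ (-(a : ℂ)) * Complex.Gamma a := by
    ext ξ
    rw [← integral_cpow_mul_cexp_neg_mul (by simp; linarith) (by simpa),
      Real.fourier_real_eq_integral_exp_smul, ← integral_indicator measurableSet_Ioi]
    congr 1 with r
    by_cases hr : r ∈ Set.Ioi 0
    · simp only [hf, Set.indicator_of_mem hr, smul_eq_mul]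
      rw [mul_left_comm, ← Complex.exp_add]
      congr 2
      push_cast
      ring
    · simp [hf, Set.indicator_of_notMem hr]
  have hF_int : Integrable (𝓕 f) := by
    rw [hF]
    exact ((integrable_add_mul_I_cpow_neg ha hc).comp_mul_left' (by positivity)).mul_const _
  have hcont : ContinuousAt f t := by
    have h : ContinuousAt (fun r : ℝ ↦ (r : ℂ) ^ ((a : ℂ) - 1) * cexp (-(c * r))) t := by
      refine ContinuousAt.mul ?_ (by fun_prop)
      exact (continuousAt_cpow_const (Or.inl (by simpa))).comp continuous_ofReal.continuousAt
    refine h.congr ?_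
    filter_upwards [lt_mem_nhds ht] with r hr
    rw [hf, Set.indicator_of_mem (Set.mem_Ioi.2 hr)]
  have hinv := hf_int.fourierInv_fourier_eq hF_int hcont
  rw [hf, Set.indicator_of_mem (Set.mem_Ioi.2 ht), ← hf, Real.fourierInv_eq', hF] at hinv
  have hsub := Measure.integral_comp_mul_left
    (fun x : ℝ ↦ ((c : ℂ) + x * I) ^ (-(a : ℂ)) * cexp (t * x * I) * Complex.Gamma a) (2 * π)
  rw [abs_of_pos (by positivity), real_smul] at hsub
  have heq : ∀ v : ℝ, cexp (↑(2 * π * inner ℝ v t) * I) •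
      (((c : ℂ) + (2 * π * v : ℝ) * I) ^ (-(a : ℂ)) * Complex.Gamma a) =
      ((c : ℂ) + (2 * π * v : ℝ) * I) ^ (-(a : ℂ)) * cexp (t * (2 * π * v : ℝ) * I) *
        Complex.Gamma a := fun v ↦ by
    rw [smul_eq_mul, show inner ℝ v t = t * v from rfl,
      show ((2 * π * (t * v) : ℝ) : ℂ) * I = t * (2 * π * v : ℝ) * I by push_cast; ring]
    ring
  simp only [heq] at hinv
  rw [← integral_mul_const, ← hinv, hsub, ofReal_inv, ← ofReal_ofNat, ← ofReal_mul,
    mul_inv_cancel_left₀ (ofReal_ne_zero.2 (by positivity))]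

/-- The kernel `((z - w̄) / (2i)) ^ (-5/2)` on the upper half-plane. -/
noncomputable def halfPlaneKernel (z w : ℂ) : ℂ :=
  ((z - (starRingEnd ℂ) w) / (2 * I)) ^ (-(5 : ℂ) / 2)

lemma sub_conj_div_two_I (z w : ℂ) :
    (z - (starRingEnd ℂ) w) / (2 * I) =
      (((z.im + w.im) / 2 : ℝ) : ℂ) + ((w.re - z.re) / 2 : ℝ) * I := by
  rw [div_eq_iff (by simp)]
  apply Complex.ext <;> simp

lemma measurable_halfPlaneKernel (z : ℂ) : Measurable (halfPlaneKernel z) := by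
  unfold halfPlaneKernel
  fun_prop

lemma norm_halfPlaneKernel_le {z w : ℂ} (hz : 0 < z.im) (hw : 0 < w.im) :
    ‖halfPlaneKernel z w‖ ≤
      (min z.im 1 ^ 2 / 4) ^ (-(5 / 2 : ℝ) / 2) * (1 + ‖w - z.re‖ ^ 2) ^ (-(5 / 2 : ℝ) / 2) := by
  have hm : 0 < min z.im 1 := lt_min hz one_pos
  have h1 : min z.im 1 ^ 2 ≤ z.im ^ 2 := by gcongr; exact min_le_left _ _
  have h2 : min z.im 1 ^ 2 ≤ 1 := pow_le_one₀ hm.le (min_le_right _ _)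
  rw [halfPlaneKernel, show -(5 : ℂ) / 2 = ((-(5 / 2) : ℝ) : ℂ) by push_cast; ring,
    norm_cpow_real, sub_conj_div_two_I, norm_add_mul_I, Real.sqrt_eq_rpow,
    ← Real.rpow_mul (by positivity), ← Real.mul_rpow (by positivity) (by positivity),
    show 1 / 2 * -(5 / 2 : ℝ) = -(5 / 2) / 2 by ring]
  refine Real.rpow_le_rpow_of_nonpos (by positivity) ?_ (by norm_num)
  rw [← normSq_eq_norm_sq, normSq_apply]
  simp only [sub_re, sub_im, ofReal_re, ofReal_im, sub_zero]
  nlinarith [mul_pos hz hw, mul_nonneg (sub_nonneg.2 h2) (sq_nonneg (w.re - z.re)),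
    mul_nonneg (sub_nonneg.2 h2) (sq_nonneg w.im)]

/-- Uniformly in the height `y`, the weight `p² y^{1/2} e^{-y p²/2}` is at most `|p|`. -/
lemma sq_mul_exp_mul_sqrt_le {y : ℝ} (hy : 0 < y) (p : ℝ) :
    p ^ 2 * rexp (-(y * p ^ 2 / 2)) * y ^ (1 / 2 : ℝ) ≤ |p| := by
  rw [← Real.sqrt_eq_rpow, Real.exp_neg]
  have hs : |p| * √y ≤ rexp (y * p ^ 2 / 2) := by
    have h := Real.add_one_le_exp (y * p ^ 2 / 2)
    nlinarith [sq_nonneg (|p| * √y - 1), Real.sq_sqrt hy.le, sq_abs p,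
      mul_pow |p| √y 2]
  have he := Real.exp_pos (y * p ^ 2 / 2)
  calc p ^ 2 * (rexp (y * p ^ 2 / 2))⁻¹ * √y = |p| * (|p| * √y / rexp (y * p ^ 2 / 2)) := by
        rw [← sq_abs p]; field_simp
    _ ≤ |p| * 1 := by
        gcongr
        exact (div_le_one he).2 hs
    _ = |p| := mul_one _

lemma norm_cexp_I_mul_mul_sq_div_two (w : ℂ) (p : ℝ) :
    ‖cexp (I * w * (p : ℂ) ^ 2 / 2)‖ = rexp (-(w.im * p ^ 2 / 2)) := by
  have : (I * w * (p : ℂ) ^ 2 / 2) = I * w * ((p ^ 2 / 2 : ℝ) : ℂ) := by push_cast; ring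
  rw [this, norm_exp, re_mul_ofReal]
  congr 1
  simp
  ring

/-- Weighted against `p² e^{iwp²/2}`, the kernel has a dominating function in product form. -/
lemma norm_halfPlaneKernel_mul_le {z w : ℂ} (hz : 0 < z.im) (hw : 0 < w.im) (p : ℝ) :
    ‖halfPlaneKernel z w * ((p : ℂ) ^ 2 * cexp (I * w * (p : ℂ) ^ 2 / 2)) *
        ((w.im ^ ((1 : ℝ) / 2) : ℝ) : ℂ)‖ ≤
      (min z.im 1 ^ 2 / 4) ^ (-(5 / 2 : ℝ) / 2) * (1 + ‖w - z.re‖ ^ 2) ^ (-(5 / 2 : ℝ) / 2) *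
        |p| := by
  rw [norm_mul, norm_mul, norm_mul, norm_pow, norm_real, norm_real,
    norm_cexp_I_mul_mul_sq_div_two, Real.norm_eq_abs, sq_abs,
    Real.norm_of_nonneg (Real.rpow_nonneg hw.le _), mul_assoc]
  exact mul_le_mul (norm_halfPlaneKernel_le hz hw) (sq_mul_exp_mul_sqrt_le hw p) (by positivity)
    (by positivity)

lemma integrable_one_add_norm_sub_sq_rpow (a : ℂ) :
    Integrable (fun w : ℂ ↦ (1 + ‖w - a‖ ^ 2) ^ (-(5 / 2 : ℝ) / 2)) :=
  (integrable_rpow_neg_one_add_norm_sq (E := ℂ) (μ := volume) (r := 5 / 2)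
    (by rw [finrank_real_complex]; norm_num)).comp_sub_right a

lemma measurableSet_im_pos : MeasurableSet {w : ℂ | 0 < w.im} :=
  measurableSet_lt measurable_const measurable_im

lemma integrableOn_halfPlaneKernel_mul {z : ℂ} (hz : 0 < z.im) (p : ℝ) :
    IntegrableOn (fun w : ℂ ↦ halfPlaneKernel z w *
      ((p : ℂ) ^ 2 * cexp (I * w * (p : ℂ) ^ 2 / 2)) * ((w.im ^ ((1 : ℝ) / 2) : ℝ) : ℂ))
      {w : ℂ | 0 < w.im} := by
  refine Integrable.mono' (((integrable_one_add_norm_sub_sq_rpow z.re).const_mul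
    ((min z.im 1 ^ 2 / 4) ^ (-(5 / 2 : ℝ) / 2))).mul_const |p|).integrableOn ?_ ?_
  · have := measurable_halfPlaneKernel z
    exact (by fun_prop : Measurable _).aestronglyMeasurable
  · filter_upwards [ae_restrict_mem measurableSet_im_pos] with w hw
    exact norm_halfPlaneKernel_mul_le hz hw p

/-- Integration over the upper half-plane by horizontal lines. -/
lemma setIntegral_im_pos_eq {f : ℂ → ℂ} (hf : IntegrableOn f {w : ℂ | 0 < w.im}) :
    ∫ w in {w : ℂ | 0 < w.im}, f w = ∫ y in Set.Ioi (0 : ℝ), ∫ x : ℝ, f (x + y * I) := by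
  have hmp := Complex.volume_preserving_equiv_real_prod.symm
  have hemb := measurableEquivRealProd.symm.measurableEmbedding
  rw [← integrable_indicator_iff measurableSet_im_pos] at hf
  rw [← integral_indicator measurableSet_im_pos, ← integral_indicator measurableSet_Ioi,
    ← hmp.integral_comp hemb, Measure.volume_eq_prod, integral_prod_symm]
  · congr 1 with y
    by_cases hy : 0 < y
    · rw [Set.indicator_of_mem (Set.mem_Ioi.2 hy)]
      congr 1 with x
      rw [measurableEquivRealProd_symm_apply, Set.indicator_of_mem (by simpa), mk_eq_add_mul_I]
    · rw [Set.indicator_of_notMem (by simpa using hy)]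
      refine integral_eq_zero_of_ae (Filter.Eventually.of_forall fun x ↦ ?_)
      simp [measurableEquivRealProd_symm_apply, hy]
  · exact (hmp.integrable_comp_emb hemb).2 hf

lemma integral_halfPlaneKernel_mul_cexp {z : ℂ} (hz : 0 < z.im) {t y : ℝ} (ht : 0 < t)
    (hy : 0 < y) :
    (∫ x : ℝ, halfPlaneKernel z (x + y * I) * cexp (I * (x + y * I) * t)) *
        Complex.Gamma (5 / 2) =
      4 * π * (2 * t : ℝ) ^ (3 / 2 : ℂ) * cexp (I * z * t) * cexp (-((2 * t : ℝ) * y)) := by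
  have key := integral_add_mul_I_cpow_neg_mul_cexp (a := 5 / 2) (c := (z.im + y) / 2)
    (t := 2 * t) (by norm_num) (by positivity) (by positivity)
  have hsub := integral_sub_right_eq_self (μ := volume)
    (fun x : ℝ ↦ halfPlaneKernel z ((x + z.re : ℝ) + y * I) *
      cexp (I * ((x + z.re : ℝ) + y * I) * t)) z.re
  simp only [sub_add_cancel] at hsub
  have hscale := Measure.integral_comp_mul_left
    (fun x : ℝ ↦ (((z.im + y) / 2 : ℝ) + x * I : ℂ) ^ (-((5 / 2 : ℝ) : ℂ)) *
      cexp ((2 * t : ℝ) * x * I) * cexp (I * z.re * t - y * t)) (1 / 2)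
  have heq : ∀ x : ℝ, halfPlaneKernel z ((x + z.re : ℝ) + y * I) *
      cexp (I * ((x + z.re : ℝ) + y * I) * t) =
      (((z.im + y) / 2 : ℝ) + (1 / 2 * x : ℝ) * I : ℂ) ^ (-((5 / 2 : ℝ) : ℂ)) *
      cexp ((2 * t : ℝ) * (1 / 2 * x : ℝ) * I) * cexp (I * z.re * t - y * t) := fun x ↦ by
    rw [halfPlaneKernel, sub_conj_div_two_I, mul_assoc (_ ^ _), ← Complex.exp_add]
    congr 2
    · simp; ring
    · push_cast; ring
    · push_cast
      linear_combination (y * t : ℂ) * I_sq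
  simp only [← heq] at hscale
  rw [hsub, hscale, integral_mul_const, real_smul]
  have hexp : cexp (-(((z.im + y) / 2 : ℝ) * (2 * t : ℝ))) * cexp (I * z.re * t - y * t) =
      cexp (I * z * t) * cexp (-((2 * t : ℝ) * y)) := by
    rw [← Complex.exp_add, ← Complex.exp_add]
    congr 1
    conv_rhs => rw [← re_add_im z]
    push_cast
    linear_combination (-(z.im * t) : ℂ) * I_sq
  rw [show (((5 / 2 : ℝ) : ℂ)) = 5 / 2 by push_cast; rfl,
    show (5 / 2 : ℂ) - 1 = 3 / 2 by norm_num] at key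
  rw [show (((5 / 2 : ℝ) : ℂ)) = 5 / 2 by push_cast; rfl]
  rw [mul_assoc (4 * π * (2 * t : ℝ) ^ (3 / 2 : ℂ) : ℂ), ← hexp]
  norm_num
  norm_num at key
  linear_combination 2 * cexp (I * z.re * t - y * t) * key

/-- The kernel reproduces every exponential `w ↦ e^{iwt}` with `t > 0`. -/
lemma setIntegral_halfPlaneKernel_mul_cexp {z : ℂ} (hz : 0 < z.im) (p : ℝ) :
    ∫ w in {w : ℂ | 0 < w.im}, halfPlaneKernel z w *
        ((p : ℂ) ^ 2 * cexp (I * w * (p : ℂ) ^ 2 / 2)) * ((w.im ^ ((1 : ℝ) / 2) : ℝ) : ℂ) =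
      8 * π / 3 * ((p : ℂ) ^ 2 * cexp (I * z * (p : ℂ) ^ 2 / 2)) := by
  rcases eq_or_ne p 0 with rfl | hp
  · simp
  have ht : 0 < p ^ 2 / 2 := by positivity
  set t := p ^ 2 / 2 with htdef
  have hpt : ∀ w : ℂ, I * w * (p : ℂ) ^ 2 / 2 = I * w * t := fun w ↦ by
    rw [htdef]; push_cast; ring
  have hG : Complex.Gamma (3 / 2) ≠ 0 := Gamma_ne_zero_of_re_pos (by norm_num)
  have hG' : Complex.Gamma (5 / 2) = 3 / 2 * Complex.Gamma (3 / 2) := by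
    rw [← Complex.Gamma_add_one _ (by norm_num)]; norm_num
  rw [setIntegral_im_pos_eq (integrableOn_halfPlaneKernel_mul hz p)]
  have hinner : ∀ y ∈ Set.Ioi (0 : ℝ), (∫ x : ℝ, halfPlaneKernel z (x + y * I) *
      ((p : ℂ) ^ 2 * cexp (I * (x + y * I) * (p : ℂ) ^ 2 / 2)) *
        ((((x : ℂ) + y * I).im ^ ((1 : ℝ) / 2) : ℝ) : ℂ)) =
      (p : ℂ) ^ 2 * (4 * π * (2 * t : ℝ) ^ (3 / 2 : ℂ) * cexp (I * z * t)) /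
        Complex.Gamma (5 / 2) *
        ((y : ℂ) ^ ((3 / 2 : ℂ) - 1) * cexp (-((2 * t : ℝ) * y))) := fun y hy ↦ by
    have hy : 0 < y := hy
    have h := integral_halfPlaneKernel_mul_cexp hz ht hy
    rw [div_mul_eq_mul_div, eq_div_iff (by rw [hG']; simpa using hG)]
    have hyc : ((y ^ ((1 : ℝ) / 2) : ℝ) : ℂ) = (y : ℂ) ^ ((3 / 2 : ℂ) - 1) := by
      rw [ofReal_cpow hy.le]; norm_num
    calc _ = ((p : ℂ) ^ 2 * (y : ℂ) ^ ((3 / 2 : ℂ) - 1)) *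
          ((∫ x : ℝ, halfPlaneKernel z (x + y * I) * cexp (I * (x + y * I) * t)) *
            Complex.Gamma (5 / 2)) := by
          rw [← mul_assoc, ← integral_const_mul]
          congr 2 with x
          rw [hpt, ← hyc]
          simp
          ring
      _ = _ := by rw [h]; ring
  rw [setIntegral_congr_fun measurableSet_Ioi hinner, integral_const_mul,
    integral_cpow_mul_cexp_neg_mul (by norm_num) (by rw [ofReal_re]; positivity), hpt, hG',
    cpow_neg]
  have h2t : ((2 * t : ℝ) : ℂ) ^ (3 / 2 : ℂ) ≠ 0 := by
    rw [Ne, cpow_eq_zero_iff]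
    exact fun h ↦ (by positivity : 2 * t ≠ 0) (ofReal_eq_zero.1 h.1)
  field_simp
  ring

/-- The integrand of the double integral over the half-plane and the line is integrable. -/
lemma integrable_halfPlaneKernel_mul_schwartz {z : ℂ} (hz : 0 < z.im) (ψ : SchwartzMap ℝ ℂ) :
    Integrable (fun q : ℂ × ℝ ↦ halfPlaneKernel z q.1 *
      ((q.2 : ℂ) ^ 2 * cexp (I * q.1 * (q.2 : ℂ) ^ 2 / 2)) *
      ((q.1.im ^ ((1 : ℝ) / 2) : ℝ) : ℂ) * ψ q.2)
      ((volume.restrict {w : ℂ | 0 < w.im}).prod volume) := by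
  have hψ : Integrable (fun p : ℝ ↦ |p| * ‖ψ p‖) := by
    simpa using ψ.integrable_pow_mul volume 1
  have hdom := (((integrable_one_add_norm_sub_sq_rpow z.re).const_mul
    ((min z.im 1 ^ 2 / 4) ^ (-(5 / 2 : ℝ) / 2))).integrableOn (s := {w : ℂ | 0 < w.im})).mul_prod hψ
  refine hdom.mono' ?_ ?_
  · have := (measurable_halfPlaneKernel z)
    have := ψ.continuous.measurable
    exact (by fun_prop : Measurable _).aestronglyMeasurable
  · have hmem : ∀ᵐ q ∂((volume.restrict {w : ℂ | 0 < w.im}).prod (volume : Measure ℝ)),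
        0 < q.1.im :=
      Measure.quasiMeasurePreserving_fst.ae (ae_restrict_mem measurableSet_im_pos)
    filter_upwards [hmem] with q hq
    rw [norm_mul]
    exact (mul_le_mul_of_nonneg_right (norm_halfPlaneKernel_mul_le hz hq q.2)
      (norm_nonneg (ψ q.2))).trans_eq (mul_assoc _ _ _)

theorem reproducing_kernel_pos_half (ψ : SchwartzMap ℝ ℂ)
    (hψ : ∀ p : ℝ, ψ (-p) = ψ p)
    (F : ℂ → ℂ)
    (hF : ∀ z : ℂ, 0 < z.im →
      F z = (1 / (Real.sqrt 2 * (Real.pi : ℂ) ^ ((3 : ℂ) / 4))) *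
        ∫ p : ℝ, (p : ℂ) ^ 2 * Complex.exp (Complex.I * z * (p : ℂ) ^ 2 / 2) * ψ p)
    (z : ℂ) (hz : 0 < z.im) :
    ∫ w in {w : ℂ | 0 < w.im},
        (3 / (8 * (Real.pi : ℂ))) *
          ((z - (starRingEnd ℂ) w) / (2 * Complex.I)) ^ (-(5 : ℂ) / 2) *
          F w * ((w.im ^ ((1 : ℝ) / 2) : ℝ) : ℂ)
      = F z := by
  set A : ℂ := 1 / (Real.sqrt 2 * (Real.pi : ℂ) ^ ((3 : ℂ) / 4))
  calc _ = ∫ w in {w : ℂ | 0 < w.im}, 3 / (8 * (π : ℂ)) * A *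
        ∫ p : ℝ, halfPlaneKernel z w * ((p : ℂ) ^ 2 * cexp (I * w * (p : ℂ) ^ 2 / 2)) *
          ((w.im ^ ((1 : ℝ) / 2) : ℝ) : ℂ) * ψ p := by
        refine setIntegral_congr_fun measurableSet_im_pos fun w hw ↦ ?_
        simp only [hF w hw, ← integral_const_mul, ← integral_mul_const, halfPlaneKernel]
        congr 1 with p
        ring
    _ = 3 / (8 * (π : ℂ)) * A * ∫ p : ℝ, ∫ w in {w : ℂ | 0 < w.im},
          halfPlaneKernel z w * ((p : ℂ) ^ 2 * cexp (I * w * (p : ℂ) ^ 2 / 2)) *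
          ((w.im ^ ((1 : ℝ) / 2) : ℝ) : ℂ) * ψ p := by
        rw [integral_const_mul,
          integral_integral_swap (integrable_halfPlaneKernel_mul_schwartz hz ψ)]
    _ = F z := by
        simp_rw [integral_mul_const, setIntegral_halfPlaneKernel_mul_cexp hz]
        rw [hF z hz]
        simp_rw [mul_assoc (8 * (π : ℂ) / 3)]
        rw [integral_const_mul]
        have : 3 / (8 * (π : ℂ)) * (8 * π / 3) = 1 := by field_simp
        linear_combination (A * ∫ p : ℝ, (p : ℂ) ^ 2 * cexp (I * z * (p : ℂ) ^ 2 / 2) * ψ p) * this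
end
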